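/- arXiv:2305.09771 — 4 statements merged into one kernel-verified Lean document; each statement's English description precedes it below -/
import Mathlib

section
/- Let (R, m, k) be a Noetherian local ring of Krull dimension d whose residue field k has characteristic 2, and let P be a tiny complex over R, i.e., a complex of finite rank free R-modules of the form 0 → P_d → ⋯ → P_1 → P_0 → 0 whose homology is nonzero and of finite length. Then ∑_j rank_R(P_j) ≥ 2^{dim(R/2R)} ≥ 2^{d−1}. In particular, if 2 is nilpotent in R then ∑_j rank_R(P_j) ≥ 2^d. -/
open CategoryTheory

section HomologyLength

variable {R : Type*} [CommRing R] {K M N : Type*} [AddCommGroup K] [Module R K]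
  [AddCommGroup M] [Module R M] [AddCommGroup N] [Module R N]

/-- The homology `ker δ / im δ` of a differential module `(M, δ)`. -/
abbrev DiffHomology (δ : M →ₗ[R] M) : Type _ :=
  LinearMap.ker δ ⧸ (LinearMap.range δ).submoduleOf (LinearMap.ker δ)

/-- The length of the homology of a differential module. -/
noncomputable def homologyLength (δ : M →ₗ[R] M) : ℕ∞ :=
  Module.length R (DiffHomology δ)

/-- The map induced on homology by a morphism of differential modules. -/
noncomputable def diffHomologyMap (B : K →ₗ[R] K) (δ : M →ₗ[R] M) (φ : K →ₗ[R] M)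
    (hφ : ∀ x, δ (φ x) = φ (B x)) : DiffHomology B →ₗ[R] DiffHomology δ :=
  Submodule.mapQ _ _
    (φ.restrict (p := LinearMap.ker B) (q := LinearMap.ker δ) fun x hx => by
      rw [LinearMap.mem_ker] at hx ⊢; rw [hφ, hx, map_zero]) (by
    rintro ⟨x, hx⟩ ⟨y, hy⟩
    exact ⟨φ y, by rw [hφ, hy]; rfl⟩)

lemma diffHomologyMap_injective {B : K →ₗ[R] K} {δ : M →ₗ[R] M} {φ : K →ₗ[R] M}
    (hφ : ∀ x, δ (φ x) = φ (B x))
    (hinj : ∀ x, B x = 0 → (∃ y, φ x = δ y) → ∃ z, x = B z) :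
    Function.Injective (diffHomologyMap B δ φ hφ) := by
  rw [injective_iff_map_eq_zero]
  intro q hq
  obtain ⟨⟨x, hx⟩, rfl⟩ := Submodule.Quotient.mk_surjective _ q
  rw [diffHomologyMap, Submodule.mapQ_apply,
    Submodule.Quotient.mk_eq_zero] at hq
  obtain ⟨y, hy⟩ := hq
  obtain ⟨z, hz⟩ := hinj x hx ⟨y, hy.symm⟩
  exact (Submodule.Quotient.mk_eq_zero _).2 ⟨z, hz.symm⟩

lemma homologyLength_le_of_injOn {B : K →ₗ[R] K} {δ : M →ₗ[R] M} {φ : K →ₗ[R] M}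
    (hφ : ∀ x, δ (φ x) = φ (B x))
    (hinj : ∀ x, B x = 0 → (∃ y, φ x = δ y) → ∃ z, x = B z) :
    homologyLength B ≤ homologyLength δ :=
  Module.length_le_of_injective _ (diffHomologyMap_injective hφ hinj)

lemma homologyLength_le_add {B : K →ₗ[R] K} {δ : M →ₗ[R] M} {γ : N →ₗ[R] N}
    (φ : K →ₗ[R] M) (ψ : M →ₗ[R] N)
    (hφ : ∀ x, δ (φ x) = φ (B x)) (hψ : ∀ x, γ (ψ x) = ψ (δ x))
    (hi : Function.Injective φ) (hs : Function.Surjective ψ)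
    (hex : ∀ x, ψ x = 0 → ∃ y, φ y = x) (hδ : ∀ x, δ (δ x) = 0) :
    homologyLength δ ≤ homologyLength B + homologyLength γ := by
  set g := diffHomologyMap δ γ ψ hψ with hg
  have h1 := Module.length_eq_add_of_exact (LinearMap.ker g).subtype g.rangeRestrict
    (Submodule.subtype_injective _) g.surjective_rangeRestrict
    (by rw [LinearMap.exact_iff, LinearMap.ker_rangeRestrict, Submodule.range_subtype])
  rw [homologyLength, h1]
  refine add_le_add ?_ (Module.length_le_of_injective _ (Submodule.subtype_injective _))
  set f := diffHomologyMap B δ φ hφ with hf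
  have hle : LinearMap.ker g ≤ LinearMap.range f := by
    intro q hq
    obtain ⟨⟨x, hx⟩, rfl⟩ := Submodule.Quotient.mk_surjective _ q
    rw [LinearMap.mem_ker, hg, diffHomologyMap, Submodule.mapQ_apply,
      Submodule.Quotient.mk_eq_zero] at hq
    obtain ⟨y, hy⟩ := hq
    obtain ⟨y, rfl⟩ := hs y
    have hy' : ψ (x - δ y) = 0 := by
      rw [map_sub, ← hψ, hy]; exact sub_self _
    obtain ⟨k, hk⟩ := hex _ hy'
    have hk0 : B k = 0 := hi (by
      rw [map_zero, ← hφ, hk, map_sub, hδ, sub_zero]; exact hx)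
    refine ⟨Submodule.Quotient.mk ⟨k, hk0⟩, ?_⟩
    rw [hf, diffHomologyMap, Submodule.mapQ_apply, Submodule.Quotient.eq]
    refine ⟨-y, ?_⟩
    change δ (-y) = φ k - x
    rw [hk, map_neg]
    abel
  exact (Module.length_le_of_injective _ (Submodule.inclusion_injective hle)).trans
    (Module.length_le_of_surjective _ f.surjective_rangeRestrict)

end HomologyLength

section Twist

variable {R : Type*} [CommRing R] {D : Type*} [AddCommGroup D] [Module R D]

/-- The differential on `ι → D` given by that of `D` together with a matrix. -/
noncomputable def twistedDifferential {ι : Type*} [Fintype ι] (δ : D →ₗ[R] D) (A : Matrix ι ι R) :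
    (ι → D) →ₗ[R] (ι → D) :=
  LinearMap.pi fun i => δ ∘ₗ LinearMap.proj i + ∑ j, A i j • LinearMap.proj j

lemma twistedDifferential_apply {ι : Type*} [Fintype ι] (δ : D →ₗ[R] D) (A : Matrix ι ι R)
    (x : ι → D) (i : ι) :
    twistedDifferential δ A x i = δ (x i) + ∑ j, A i j • x j := by
  simp [twistedDifferential]

lemma twistedDifferential_sq {ι : Type*} [Fintype ι] (h2 : (2 : R) = 0) {δ : D →ₗ[R] D}
    (hδ : ∀ x, δ (δ x) = 0) {A : Matrix ι ι R} (hA : A * A = 0) (x : ι → D) :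
    twistedDifferential δ A (twistedDifferential δ A x) = 0 := by
  ext i
  have h2' : ∀ z : D, z + z = 0 := fun z => by rw [← two_smul R, h2, zero_smul]
  have hAA : ∑ j, A i j • ∑ k, A j k • x k = 0 := by
    simp_rw [Finset.smul_sum, smul_smul]
    rw [Finset.sum_comm]
    simp_rw [← Finset.sum_smul]
    refine Finset.sum_eq_zero fun k _ => ?_
    have := congrFun (congrFun hA i) k
    rw [Matrix.mul_apply] at this
    rw [this, Matrix.zero_apply, zero_smul]
  simp only [twistedDifferential_apply, map_add, hδ, zero_add, smul_add, Finset.sum_add_distrib,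
    map_sum, map_smul, hAA, add_zero, h2', Pi.zero_apply]

lemma homologyLength_twistedDifferential_le (h2 : (2 : R) = 0) {δ : D →ₗ[R] D}
    (hδ : ∀ x, δ (δ x) = 0) (n : ℕ) :
    ∀ {ι : Type*} [Fintype ι] (_ : Fintype.card ι = n) (A : Matrix ι ι R) (_ : A * A = 0)
      (w : ι → ℕ) (_ : ∀ i j, w j ≤ w i → A i j = 0),
      homologyLength (twistedDifferential δ A) ≤ n * homologyLength δ := by
  classical
  induction n with
  | zero =>
    intro ι _ hι A _ w _
    have := Fintype.card_eq_zero_iff.1 hι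
    have hs : Subsingleton (DiffHomology (twistedDifferential δ A)) :=
      (Submodule.Quotient.mk_surjective _).subsingleton
    rw [homologyLength, Module.length_eq_zero]
    exact zero_le
  | succ n ih =>
    intro ι _ hι A hA w hw
    have : Nonempty ι := Fintype.card_pos_iff.1 (by omega)
    obtain ⟨i₀, hi₀⟩ := Finite.exists_min w
    have hcol : ∀ i, A i i₀ = 0 := fun i => hw _ _ (hi₀ i)
    let A' : Matrix {i // i ≠ i₀} {i // i ≠ i₀} R := A.submatrix Subtype.val Subtype.val
    have hA' : A' * A' = 0 := by
      ext i j
      have := congrFun (congrFun hA i) j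
      rw [Matrix.mul_apply, Fintype.sum_eq_add_sum_subtype_ne _ i₀, hcol, zero_mul,
          zero_add] at this
      rw [Matrix.mul_apply]
      exact this
    have h := ih (ι := {i // i ≠ i₀}) (by simp [Fintype.card_subtype_compl, hι]) A' hA'
      (fun i => w i) (fun i j => hw i j)
    have key := homologyLength_le_add (B := δ) (δ := twistedDifferential δ A)
      (γ := twistedDifferential δ A') (LinearMap.single R (fun _ => D) i₀)
      (LinearMap.funLeft R D Subtype.val)
      (fun x => by
        ext i
        rw [twistedDifferential_apply, Fintype.sum_eq_add_sum_subtype_ne _ i₀, hcol,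
          Finset.sum_eq_zero (fun j _ => by simp [Pi.single_eq_of_ne j.2])]
        by_cases hi : i = i₀
        · subst hi; simp
        · simp [hi])
      (fun x => by
        ext i
        rw [LinearMap.funLeft_apply, twistedDifferential_apply, twistedDifferential_apply,
          Fintype.sum_eq_add_sum_subtype_ne _ i₀, hcol, zero_smul, zero_add]
        rfl)
      (Pi.single_injective (M := fun _ : ι => D) i₀)
      (LinearMap.funLeft_surjective_of_injective _ _ _ Subtype.val_injective)
      (fun x hx => ⟨x i₀, by
        ext i
        by_cases hi : i = i₀
        · subst hi; simp
        · simpa [hi] using (congrFun hx ⟨i, hi⟩).symm⟩)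
      (twistedDifferential_sq h2 hδ hA)
    refine key.trans ((add_le_add_right h _).trans_eq ?_)
    push_cast
    ring

end Twist

section TensorSquare

open scoped Kronecker

variable {R : Type*} [CommRing R] {ι : Type*} [DecidableEq ι]

/-- The differential of the tensor square of a differential module in characteristic two. -/
def tensorSquareMatrix (A : Matrix ι ι R) : Matrix (ι × ι) (ι × ι) R := A ⊗ₖ 1 + 1 ⊗ₖ A

/-- One plus the permutation matrix of the swap of the two tensor factors. -/
def oneAddSwapMatrix (R ι : Type*) [CommRing R] [DecidableEq ι] : Matrix (ι × ι) (ι × ι) R :=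
  1 + (1 : Matrix (ι × ι) (ι × ι) R).submatrix Prod.swap id

lemma tensorSquareMatrix_apply (A : Matrix ι ι R) (p q : ι × ι) :
    tensorSquareMatrix A p q =
      (if p.2 = q.2 then A p.1 q.1 else 0) + (if p.1 = q.1 then A p.2 q.2 else 0) := by
  simp [tensorSquareMatrix, Matrix.one_apply]

lemma tensorSquareMatrix_sq [Fintype ι] (h2 : (2 : R) = 0) {A : Matrix ι ι R} (hA : A * A = 0) :
    tensorSquareMatrix A * tensorSquareMatrix A = 0 := by
  have : A ⊗ₖ A + A ⊗ₖ A = 0 := by rw [← two_smul R, h2, zero_smul]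
  simp only [tensorSquareMatrix, mul_add, add_mul, ← Matrix.mul_kronecker_mul, hA, mul_one,
    one_mul, Matrix.zero_kronecker, Matrix.kronecker_zero, zero_add, add_zero, this]

lemma oneAddSwapMatrix_sq [Fintype ι] (h2 : (2 : R) = 0) :
    oneAddSwapMatrix R ι * oneAddSwapMatrix R ι = 0 := by
  have hP : (1 : Matrix (ι × ι) (ι × ι) R).submatrix Prod.swap id *
      (1 : Matrix (ι × ι) (ι × ι) R).submatrix Prod.swap id = 1 := by
    ext p q
    rw [Matrix.mul_apply, Finset.sum_eq_single p.swap]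
    · simp [Matrix.one_apply]
    · intro b _ hb
      simp [hb.symm]
    · simp
  have h (M : Matrix (ι × ι) (ι × ι) R) : M + M = 0 := by rw [← two_smul R, h2, zero_smul]
  simp only [oneAddSwapMatrix, mul_add, add_mul, hP, mul_one, one_mul]
  rw [add_comm _ 1, h]

lemma oneAddSwapMatrix_comm [Fintype ι] (A : Matrix ι ι R) :
    oneAddSwapMatrix R ι * tensorSquareMatrix A = tensorSquareMatrix A * oneAddSwapMatrix R ι := by
  rw [oneAddSwapMatrix, add_mul, mul_add, one_mul, mul_one]
  congr 1
  ext p q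
  rw [Matrix.mul_apply, Matrix.mul_apply, Finset.sum_eq_single p.swap,
    Finset.sum_eq_single q.swap]
  · simp [tensorSquareMatrix_apply, add_comm, Matrix.one_apply]
  · intro b _ hb
    have : b.swap ≠ q := fun h => hb (by rw [← h, Prod.swap_swap])
    simp [this]
  · simp
  · intro b _ hb
    simp [hb.symm]
  · simp

lemma homologyLength_tensorSquareMatrix_le [Fintype ι] (h2 : (2 : R) = 0) {A : Matrix ι ι R}
    (hA : A * A = 0)
    {w : ι → ℕ} (hw : ∀ i j, w j ≤ w i → A i j = 0) :
    homologyLength (tensorSquareMatrix A).mulVecLin ≤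
      Fintype.card ι * homologyLength A.mulVecLin := by
  have hδ : ∀ x, A.mulVecLin (A.mulVecLin x) = 0 := fun x => by
    simp [Matrix.mulVec_mulVec, hA]
  refine le_trans ?_ (homologyLength_twistedDifferential_le h2 hδ _ rfl A hA w hw)
  let e : (ι × ι → R) ≃ₗ[R] (ι → ι → R) := LinearEquiv.curry R R ι ι
  have he : ∀ x, twistedDifferential A.mulVecLin A (e x) =
      e ((tensorSquareMatrix A).mulVecLin x) := by
    intro x
    ext i j
    rw [twistedDifferential_apply]
    simp only [e, LinearEquiv.coe_curry, Function.curry_apply, Matrix.mulVecLin_apply,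
      Matrix.mulVec, dotProduct, tensorSquareMatrix_apply, add_mul, Finset.sum_add_distrib,
      Fintype.sum_prod_type, Pi.add_apply, Finset.sum_apply, Pi.smul_apply, smul_eq_mul, ite_mul,
      zero_mul, Finset.sum_ite_eq, Finset.mem_univ, if_true]
    rw [add_comm]
    congr 1
    rw [Finset.sum_comm]
    simp
  refine homologyLength_le_of_injOn (φ := e.toLinearMap) he fun x _ ⟨y, hy⟩ => ⟨e.symm y, ?_⟩
  apply e.injective
  rw [← he, e.apply_symm_apply]
  exact hy

end TensorSquare

section Elimination

variable {R : Type*} [CommRing R] {κ ι α : Type*} [Fintype κ] [Fintype ι] [Fintype α]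

lemma mulVec_comp_of_bijective {β : Type*} (Δ : Matrix κ κ R) {k : ι → κ} {u v : α → κ}
    (hbij : Function.Bijective (Sum.elim k (Sum.elim u v))) (f : β → κ) (y : κ → R) :
    (Δ.mulVec y) ∘ f = (Δ.submatrix f k).mulVec (y ∘ k) + (Δ.submatrix f u).mulVec (y ∘ u) +
      (Δ.submatrix f v).mulVec (y ∘ v) := by
  ext b
  simp only [Function.comp_apply, Matrix.mulVec, dotProduct, Pi.add_apply, Matrix.submatrix_apply]
  rw [← (Equiv.ofBijective _ hbij).sum_comp, Fintype.sum_sum_type, Fintype.sum_sum_type, add_assoc]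
  rfl

variable [DecidableEq α]

/-- The differential obtained from `Δ` by cancelling the invertible block with columns `u` and
rows `v`. -/
noncomputable def eliminationMatrix (Δ : Matrix κ κ R) (k : ι → κ) (u v : α → κ) : Matrix ι ι R :=
  Δ.submatrix k k - Δ.submatrix k u * (Δ.submatrix v u)⁻¹ * Δ.submatrix v k

/-- Gaussian elimination: cancelling an invertible block of a differential does not change the
homology. -/
lemma exists_eliminationMap {Δ : Matrix κ κ R} (hΔ : Δ * Δ = 0) {k : ι → κ} {u v : α → κ}
    (hbij : Function.Bijective (Sum.elim k (Sum.elim u v)))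
    (hdet : IsUnit (Δ.submatrix v u).det) :
    ∃ inc : (ι → R) →ₗ[R] (κ → R), Function.Injective inc ∧
      (∀ x, Δ.mulVec (inc x) = inc ((eliminationMatrix Δ k u v).mulVec x)) ∧
      (∀ x y, inc x = Δ.mulVec y → ∃ z, x = (eliminationMatrix Δ k u v).mulVec z) ∧
      (∀ y, Δ.mulVec y = 0 → ∃ x z, (eliminationMatrix Δ k u v).mulVec x = 0 ∧
        y = inc x + Δ.mulVec z) := by
  classical
  set Θ := Δ.submatrix v u with hΘ
  let e := Equiv.ofBijective _ hbij
  have ek : ∀ i, e.symm (k i) = Sum.inl i := fun i => e.symm_apply_eq.2 rfl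
  have eu : ∀ i, e.symm (u i) = Sum.inr (Sum.inl i) := fun i => e.symm_apply_eq.2 rfl
  have ev : ∀ i, e.symm (v i) = Sum.inr (Sum.inr i) := fun i => e.symm_apply_eq.2 rfl
  have hext : ∀ y y' : κ → R, y ∘ k = y' ∘ k → y ∘ u = y' ∘ u → y ∘ v = y' ∘ v → y = y' := by
    intro y y' h1 h2 h3
    ext j
    obtain ⟨s, rfl⟩ := e.surjective j
    rcases s with i | i | i
    · exact congrFun h1 i
    · exact congrFun h2 i
    · exact congrFun h3 i
  have hsq : ∀ y, Δ.mulVec (Δ.mulVec y) = 0 := fun y => by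
    rw [Matrix.mulVec_mulVec, hΔ, Matrix.zero_mulVec]
  let emb : (α → R) → (κ → R) := fun a => Sum.elim 0 (Sum.elim a 0) ∘ e.symm
  let inc : (ι → R) →ₗ[R] (κ → R) :=
    { toFun := fun x => Sum.elim x
        (Sum.elim (-(Θ⁻¹ * Δ.submatrix v k).mulVec x) 0) ∘ e.symm
      map_add' := fun x y => by
        apply hext <;> ext i <;> simp [ek, eu, ev, Matrix.mulVec_add, add_comm]
      map_smul' := fun c y => by
        apply hext <;> ext i <;> simp [ek, eu, ev, Matrix.mulVec_smul] }
  have ink : ∀ x, inc x ∘ k = x := fun x => by ext i; simp [inc, ek]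
  have inu : ∀ x, inc x ∘ u = -(Θ⁻¹ * Δ.submatrix v k).mulVec x := fun x => by
    ext i; simp [inc, eu]
  have inv : ∀ x, inc x ∘ v = 0 := fun x => by ext i; simp [inc, ev]
  have hchar : ∀ y : κ → R, y ∘ v = 0 → (Δ.mulVec y) ∘ v = 0 → y = inc (y ∘ k) := by
    intro y h1 h2
    refine hext _ _ (ink _).symm ?_ (h1.trans (inv _).symm)
    rw [mulVec_comp_of_bijective _ hbij, h1, Matrix.mulVec_zero, add_zero, add_comm] at h2
    rw [inu, ← Matrix.mulVec_mulVec, eq_neg_iff_add_eq_zero]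
    have := congrArg Θ⁻¹.mulVec h2
    rwa [Matrix.mulVec_add, Matrix.mulVec_mulVec, Matrix.nonsing_inv_mul _ hdet, Matrix.one_mulVec,
      Matrix.mulVec_zero] at this
  have hincv : ∀ x, (Δ.mulVec (inc x)) ∘ v = 0 := fun x => by
    rw [mulVec_comp_of_bijective _ hbij, ink, inu, inv, Matrix.mulVec_zero, add_zero,
      Matrix.mulVec_neg, ← hΘ,
      Matrix.mulVec_mulVec, ← Matrix.mul_assoc, Matrix.mul_nonsing_inv _ hdet, Matrix.one_mul,
      add_neg_cancel]
  have hinck : ∀ x, (Δ.mulVec (inc x)) ∘ k = (eliminationMatrix Δ k u v).mulVec x := fun x => by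
    rw [mulVec_comp_of_bijective _ hbij, ink, inu, inv, Matrix.mulVec_zero, add_zero,
      Matrix.mulVec_neg,
      Matrix.mulVec_mulVec, ← Matrix.mul_assoc, eliminationMatrix, Matrix.sub_mulVec,
      sub_eq_add_neg]
  have hinj : Function.Injective inc := fun x y h => by rw [← ink x, h, ink]
  have hchain : ∀ x, Δ.mulVec (inc x) = inc ((eliminationMatrix Δ k u v).mulVec x) := fun x => by
    rw [← hinck]
    exact hchar _ (hincv x) (by rw [hsq]; rfl)
  have hsub : ∀ y, ∃ z, (y - Δ.mulVec z) ∘ v = 0 := fun y => by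
    refine ⟨emb (Θ⁻¹.mulVec (y ∘ v)), ?_⟩
    have h1 : ∀ a, emb a ∘ k = 0 := fun a => by ext i; simp [emb, ek]
    have h2 : ∀ a, emb a ∘ u = a := fun a => by ext i; simp [emb, eu]
    have h3 : ∀ a, emb a ∘ v = 0 := fun a => by ext i; simp [emb, ev]
    change y ∘ v - (Δ.mulVec _) ∘ v = 0
    rw [mulVec_comp_of_bijective _ hbij, h1, h2, h3, Matrix.mulVec_zero, Matrix.mulVec_zero,
      zero_add, add_zero, Matrix.mulVec_mulVec, Matrix.mul_nonsing_inv _ hdet, Matrix.one_mulVec,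
      sub_self]
  refine ⟨inc, hinj, hchain, fun x y hxy => ?_, fun y hy => ?_⟩
  · obtain ⟨z, hz⟩ := hsub y
    have hd : Δ.mulVec (y - Δ.mulVec z) = inc x := by
      rw [Matrix.mulVec_sub, hsq, sub_zero, hxy]
    have := hchar _ hz (by rw [hd, inv])
    refine ⟨(y - Δ.mulVec z) ∘ k, hinj ?_⟩
    rw [← hchain, ← this, hd]
  · obtain ⟨z, hz⟩ := hsub y
    have hd : Δ.mulVec (y - Δ.mulVec z) = 0 := by
      rw [Matrix.mulVec_sub, hsq, sub_zero, hy]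
    have := hchar _ hz (by rw [hd]; rfl)
    refine ⟨(y - Δ.mulVec z) ∘ k, z, hinj ?_, ?_⟩
    · rw [← hchain, ← this, hd, map_zero]
    · rw [← this, sub_add_cancel]

lemma eliminationMatrix_sq {Δ : Matrix κ κ R} (hΔ : Δ * Δ = 0) {k : ι → κ} {u v : α → κ}
    (hbij : Function.Bijective (Sum.elim k (Sum.elim u v)))
    (hdet : IsUnit (Δ.submatrix v u).det) :
    eliminationMatrix Δ k u v * eliminationMatrix Δ k u v = 0 := by
  classical
  obtain ⟨inc, hinj, hchain, -, -⟩ := exists_eliminationMap hΔ hbij hdet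
  apply Matrix.ext_of_mulVec_single
  intro i
  rw [Matrix.zero_mulVec, ← Matrix.mulVec_mulVec]
  apply hinj
  rw [← hchain, ← hchain, Matrix.mulVec_mulVec, hΔ, Matrix.zero_mulVec, map_zero]

lemma homologyLength_eliminationMatrix_le {Δ : Matrix κ κ R} (hΔ : Δ * Δ = 0) {k : ι → κ}
    {u v : α → κ} (hbij : Function.Bijective (Sum.elim k (Sum.elim u v)))
    (hdet : IsUnit (Δ.submatrix v u).det) :
    homologyLength (eliminationMatrix Δ k u v).mulVecLin ≤ homologyLength Δ.mulVecLin := by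
  obtain ⟨inc, -, hchain, hinj, -⟩ := exists_eliminationMap hΔ hbij hdet
  exact homologyLength_le_of_injOn (φ := inc) hchain fun x _ ⟨y, hy⟩ => hinj x y hy

end Elimination

section GenericParameter

open Polynomial

/-- The polynomials whose lowest nonzero coefficient is one. -/
def lowestCoeffOneSubmonoid (R : Type*) [CommRing R] : Submonoid R[X] where
  carrier := {p | ∃ (k : ℕ) (g : R[X]), g.coeff 0 = 1 ∧ p = X ^ k * g}
  one_mem' := ⟨0, 1, by simp⟩
  mul_mem' := by
    rintro _ _ ⟨k, g, hg, rfl⟩ ⟨l, h, hh, rfl⟩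
    exact ⟨k + l, g * h, by rw [mul_coeff_zero, hg, hh, one_mul], by ring⟩

/-- The localization of `R[X]` in which `X` is a generic unit specializing to zero. -/
abbrev GenericParameterRing (R : Type*) [CommRing R] : Type _ :=
  Localization (lowestCoeffOneSubmonoid R)

variable {R : Type*} [CommRing R]

lemma lowestCoeffOneSubmonoid_le_nonZeroDivisors :
    lowestCoeffOneSubmonoid R ≤ nonZeroDivisors R[X] := by
  rintro _ ⟨k, g, hg, rfl⟩
  refine mul_mem (pow_mem (isRegular_X.mem_nonZeroDivisors) k) ?_
  rw [mem_nonZeroDivisors_iff_right]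
  intro h hh
  by_contra hne
  have : Nontrivial R := Polynomial.nontrivial_iff.1 (nontrivial_of_ne h 0 hne)
  have hg0 : g.natTrailingDegree = 0 := by
    rw [natTrailingDegree_eq_zero, hg]
    exact Or.inr one_ne_zero
  have h1 := coeff_mul_natTrailingDegree_add_natTrailingDegree (p := h) (q := g)
  rw [hh, coeff_zero, trailingCoeff, trailingCoeff, hg0, hg, mul_one] at h1
  exact hne (trailingCoeff_eq_zero.1 h1.symm)

lemma isUnit_algebraMap_X : IsUnit (algebraMap R[X] (GenericParameterRing R) X) :=
  IsLocalization.map_units (GenericParameterRing R) (⟨X, 1, 1, by simp⟩ : lowestCoeffOneSubmonoid R)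

lemma algebraMap_genericParameterRing_injective :
    Function.Injective (algebraMap R[X] (GenericParameterRing R)) :=
  IsLocalization.injective (GenericParameterRing R) lowestCoeffOneSubmonoid_le_nonZeroDivisors

lemma mem_of_algebraMap_mem_map {J : Ideal R} {a : R}
    (ha : algebraMap R (GenericParameterRing R) a ∈ J.map (algebraMap R (GenericParameterRing R))) :
    a ∈ J := by
  rw [IsScalarTower.algebraMap_eq R R[X] (GenericParameterRing R), ← Ideal.map_map,
    RingHom.comp_apply] at ha
  obtain ⟨_, ⟨k, g, hg, rfl⟩, hs⟩ :=
    (IsLocalization.algebraMap_mem_map_algebraMap_iff (lowestCoeffOneSubmonoid R)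
      (GenericParameterRing R) _ _).1 ha
  have := Ideal.mem_map_C_iff.1 hs k
  rwa [mul_assoc, coeff_X_pow_mul', if_pos le_rfl, Nat.sub_self, algebraMap_eq, coeff_mul_C, hg,
    one_mul] at this

lemma length_quotient_le_length_quotient_map (J : Ideal R) :
    Module.length R (R ⧸ J) ≤ Module.length (GenericParameterRing R)
      (GenericParameterRing R ⧸ J.map (algebraMap R (GenericParameterRing R))) := by
  let Φ : Submodule R (R ⧸ J) → Submodule (GenericParameterRing R)
      (GenericParameterRing R ⧸ J.map (algebraMap R (GenericParameterRing R))) := fun N =>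
    Submodule.map (Submodule.mkQ _) (Ideal.map (algebraMap R (GenericParameterRing R))
      (N.comap J.mkQ))
  have hmono : Monotone Φ := fun N N' h =>
    Submodule.map_mono (Ideal.map_mono (Submodule.comap_mono (f := J.mkQ) h))
  have hstrict : StrictMono Φ := by
    intro N N' hlt
    refine lt_of_le_not_ge (hmono hlt.le) fun hle => hlt.not_ge fun q hq => ?_
    obtain ⟨a, rfl⟩ := Submodule.mkQ_surjective _ q
    obtain ⟨b, hb, hab⟩ := hle ⟨algebraMap R (GenericParameterRing R) a,
      Ideal.mem_map_of_mem _ hq, rfl⟩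
    rw [Submodule.mkQ_apply, Submodule.mkQ_apply, Submodule.Quotient.eq] at hab
    have hJ : J ≤ Submodule.comap J.mkQ N := fun j hj => by
      rw [Submodule.mem_comap, Submodule.mkQ_apply, (Submodule.Quotient.mk_eq_zero _).2 hj]
      exact N.zero_mem
    have := sub_mem hb (Ideal.map_mono hJ hab)
    rw [sub_sub_cancel] at this
    exact mem_of_algebraMap_mem_map this
  rw [← WithBot.coe_le_coe, Module.coe_length, Module.coe_length]
  exact Order.krullDim_le_of_strictMono Φ hstrict

lemma homologyLength_generic_le [IsNoetherianRing R] {κ : Type*} [Fintype κ] (A F : Matrix κ κ R)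
    (hΔ : (A.map C + (X : R[X]) • F.map C) * (A.map C + (X : R[X]) • F.map C) = 0) :
    homologyLength ((A.map C + (X : R[X]) • F.map C).map
      (algebraMap R[X] (GenericParameterRing R))).mulVecLin ≤
      homologyLength A.mulVecLin := by
  set Δ := A.map C + (X : R[X]) • F.map C with hΔdef
  set δ := (Δ.map (algebraMap R[X] (GenericParameterRing R))).mulVecLin with hδ
  let ι : (κ → R[X]) →ₗ[R[X]] (κ → GenericParameterRing R) :=
    (Algebra.linearMap R[X] (GenericParameterRing R)).compLeft κ
  let ev : (κ → R[X]) →ₗ[R] (κ → R) := (lcoeff R 0).compLeft κ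
  have hιΔ : ∀ y, δ (ι y) = ι (Δ.mulVec y) := fun y => by
    ext i
    exact (RingHom.map_mulVec (algebraMap R[X] (GenericParameterRing R)) Δ y i).symm
  have hιinj : Function.Injective ι := fun x y h => by
    ext1 i
    exact algebraMap_genericParameterRing_injective (congrFun h i)
  have hev : ∀ y, ev (Δ.mulVec y) = A.mulVec (ev y) := fun y => by
    ext i
    simp [ev, Matrix.mulVec, dotProduct, hΔdef, mul_coeff_zero]
  have hδδ : ∀ y, δ (δ y) = 0 := fun y => by
    rw [hδ, Matrix.mulVecLin_apply, Matrix.mulVecLin_apply, Matrix.mulVec_mulVec, ← Matrix.map_mul,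
      hΔ, Matrix.map_zero _ (map_zero _), Matrix.zero_mulVec]
  let lift : Submodule (GenericParameterRing R) (DiffHomology δ) →
      Submodule (GenericParameterRing R) (κ → GenericParameterRing R) := fun N =>
    (N.comap (Submodule.mkQ _)).map (LinearMap.ker δ).subtype
  let pull : Submodule (GenericParameterRing R) (DiffHomology δ) →
      Submodule R[X] (κ → R[X]) := fun N =>
    ((lift N).restrictScalars R[X]).comap ι
  let Φ : Submodule (GenericParameterRing R) (DiffHomology δ) →
      Submodule R (DiffHomology A.mulVecLin) := fun N =>
    ((((pull N).restrictScalars R).map ev).comap (LinearMap.ker A.mulVecLin).subtype).map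
      (Submodule.mkQ _)
  have hrange : ∀ N y, δ y ∈ lift N := fun N y =>
    ⟨⟨δ y, hδδ y⟩, by
      rw [SetLike.mem_coe, Submodule.mem_comap, Submodule.mkQ_apply]
      convert N.zero_mem
      exact (Submodule.Quotient.mk_eq_zero _).2 ⟨y, rfl⟩, rfl⟩
  have hker : ∀ N x, x ∈ lift N → δ x = 0 := by
    rintro N _ ⟨⟨x, hx⟩, -, rfl⟩
    exact hx
  have hpull : Monotone pull := fun N N' h x hx =>
    Submodule.map_mono (f := (LinearMap.ker δ).subtype)
      (Submodule.comap_mono (f := Submodule.mkQ _) h) hx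
  have hmono : Monotone Φ := fun N N' h =>
    Submodule.map_mono (Submodule.comap_mono (f := (LinearMap.ker A.mulVecLin).subtype)
      (Submodule.map_mono (f := ev) (hpull h)))
  have hlift : ∀ N N', lift N' ≤ lift N → N' ≤ N := by
    intro N N' h q hq
    obtain ⟨x, rfl⟩ := Submodule.Quotient.mk_surjective _ q
    obtain ⟨y, hy, hyx⟩ := h ⟨x, hq, rfl⟩
    obtain rfl : y = x := Subtype.ext hyx
    exact hy
  have hstrict : StrictMono Φ := by
    intro N N' hlt
    refine lt_of_le_not_ge (hmono hlt.le) fun hle => hlt.not_ge (hlift _ _ ?_)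
    have hsup : pull N' ≤ pull N ⊔ Ideal.span {(X : R[X])} • pull N' := by
      intro x hx
      have hx0 : Δ.mulVec x = 0 := hιinj (by rw [← hιΔ, map_zero]; exact hker _ _ hx)
      have hAx : A.mulVecLin (ev x) = 0 := by
        rw [Matrix.mulVecLin_apply, ← hev, hx0, map_zero]
      obtain ⟨⟨c, hc⟩, ⟨y, hy, hyc⟩, hcx⟩ := hle ⟨⟨ev x, hAx⟩, ⟨x, hx, rfl⟩, rfl⟩
      rw [Submodule.mkQ_apply, Submodule.mkQ_apply, Submodule.Quotient.eq] at hcx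
      obtain ⟨z, hz⟩ := hcx
      replace hz : A.mulVec z = c - ev x := hz
      replace hyc : ev y = c := hyc
      set y₂ := Δ.mulVec (fun i => C (z i)) with hy₂
      have hy₂N : ∀ N, y₂ ∈ pull N := fun N => by
        rw [Submodule.mem_comap, hy₂, ← hιΔ]
        exact hrange N _
      have hevz : ev (fun i => C (z i)) = z := by ext i; simp [ev]
      have h0 : ev (x - (y - y₂)) = 0 := by
        rw [map_sub, map_sub, hy₂, hev, hevz, hz, hyc]
        abel
      let x' : κ → R[X] := fun i => divX ((x - (y - y₂)) i)
      have hx' : (X : R[X]) • x' = x - (y - y₂) := by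
        ext1 i
        have h0i : ((x - (y - y₂)) i).coeff 0 = 0 := congrFun h0 i
        have := X_mul_divX_add ((x - (y - y₂)) i)
        rwa [h0i, map_zero, add_zero] at this
      have hyN : y - y₂ ∈ pull N := sub_mem hy (hy₂N N)
      have hXx' : (X : R[X]) • x' ∈ pull N' := by
        rw [hx']
        exact sub_mem hx (hpull hlt.le hyN)
      have hx'N : x' ∈ pull N' := by
        rw [Submodule.mem_comap, map_smul, Submodule.restrictScalars_mem,
          ← algebraMap_smul (GenericParameterRing R) (X : R[X])] at hXx'
        exact ((lift N').smul_mem_iff_of_isUnit isUnit_algebraMap_X).1 hXx'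
      rw [← sub_add_cancel x (y - y₂), ← hx', add_comm]
      exact Submodule.add_mem_sup hyN
        (Submodule.smul_mem_smul (Ideal.mem_span_singleton_self X) hx'N)
    obtain ⟨r, hr, hr'⟩ := Submodule.exists_sub_one_mem_and_smul_le_of_fg_of_le_sup
      (IsNoetherian.noetherian (pull N')) le_rfl hsup
    intro n hn
    obtain ⟨b, hb⟩ := IsLocalization.exist_integer_multiples_of_finite
      (lowestCoeffOneSubmonoid R) n
    choose x hx using hb
    have hιx : ι x = algebraMap R[X] (GenericParameterRing R) b • n := by
      ext i
      rw [algebraMap_smul]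
      exact hx i
    have hxN' : x ∈ pull N' := by
      rw [Submodule.mem_comap, hιx]
      exact (lift N').smul_mem _ hn
    have hrx : r • x ∈ pull N := hr' (Submodule.smul_mem_pointwise_smul x r _ hxN')
    rw [Submodule.mem_comap, map_smul, hιx, Submodule.restrictScalars_mem,
      ← algebraMap_smul (GenericParameterRing R) r] at hrx
    have hr1 : r ∈ lowestCoeffOneSubmonoid R := by
      refine ⟨0, r, ?_, by simp⟩
      have := X_dvd_iff.1 (Ideal.mem_span_singleton.1 hr)
      rwa [coeff_sub, coeff_one_zero, sub_eq_zero] at this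
    exact ((lift N).smul_mem_iff_of_isUnit (IsLocalization.map_units (GenericParameterRing R) b)).1
      (((lift N).smul_mem_iff_of_isUnit
        (IsLocalization.map_units (GenericParameterRing R) ⟨r, hr1⟩)).1 hrx)
  rw [homologyLength, homologyLength, ← WithBot.coe_le_coe, Module.coe_length, Module.coe_length]
  exact Order.krullDim_le_of_strictMono Φ hstrict

end GenericParameter

section FrobeniusTwist

open Polynomial

variable {ι : Type*}

lemma tensorSquareMatrix_mem [DecidableEq ι] {R : Type*} [CommRing R] {A : Matrix ι ι R}
    {I : Ideal R} (hI : ∀ i j, A i j ∈ I) (p q : ι × ι) : tensorSquareMatrix A p q ∈ I := by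
  rw [tensorSquareMatrix_apply]
  refine I.add_mem ?_ ?_ <;> split_ifs <;> first | exact hI _ _ | exact I.zero_mem

lemma tensorSquareMatrix_eq_zero [DecidableEq ι] {R : Type*} [CommRing R] {A : Matrix ι ι R}
    {w : ι → ℕ} (hw : ∀ i j, w j ≤ w i → A i j = 0) {p q : ι × ι}
    (h : w q.1 + w q.2 ≤ w p.1 + w p.2) : tensorSquareMatrix A p q = 0 := by
  rw [tensorSquareMatrix_apply]
  split_ifs with h1 h2 h2
  · have h1' := congrArg w h1
    have h2' := congrArg w h2
    rw [hw _ _ (by omega), hw _ _ (by omega), add_zero]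
  · rw [h1] at h
    rw [hw _ _ (by omega), add_zero]
  · rw [h2] at h
    rw [hw _ _ (by omega), add_zero]
  · rw [add_zero]

lemma bijective_diag_lt_gt [LinearOrder ι] :
    Function.Bijective (Sum.elim (fun i : ι => (i, i)) (Sum.elim
      (fun p : {p : ι × ι // p.1 < p.2} => p.1)
      (fun p : {p : ι × ι // p.1 < p.2} => p.1.swap))) := by
  constructor
  · rintro (i | ⟨⟨a, b⟩, h⟩ | ⟨⟨a, b⟩, h⟩) (j | ⟨⟨c, d⟩, h'⟩ | ⟨⟨c, d⟩, h'⟩) heq <;>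
      simp only [Sum.elim_inl, Sum.elim_inr, Prod.swap_prod_mk, Prod.mk.injEq] at heq <;>
      obtain ⟨rfl, h2⟩ := heq <;> (try subst h2) <;>
      first
      | rfl
      | exact absurd h (lt_irrefl _)
      | exact absurd h' (lt_irrefl _)
      | exact absurd h h'.asymm
  · rintro ⟨a, b⟩
    rcases lt_trichotomy a b with h | rfl | h
    · exact ⟨Sum.inr (Sum.inl ⟨(a, b), h⟩), rfl⟩
    · exact ⟨Sum.inl a, rfl⟩
    · exact ⟨Sum.inr (Sum.inr ⟨(b, a), h⟩), rfl⟩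

lemma eliminationMatrix_mem {R κ α : Type*} [CommRing R] [Fintype α]
    [DecidableEq α] {Δ : Matrix κ κ R} {k : ι → κ} {u v : α → κ} {I : Ideal R}
    (hk : ∀ i j, Δ (k i) (k j) = 0) (hu : ∀ i p, Δ (k i) (u p) ∈ I)
    (hv : ∀ p j, Δ (v p) (k j) ∈ I) (i j : ι) :
    eliminationMatrix Δ k u v i j ∈ I ^ 2 := by
  rw [eliminationMatrix, Matrix.sub_apply, Matrix.submatrix_apply, hk, zero_sub, neg_mem_iff,
    Matrix.mul_apply]
  refine Ideal.sum_mem _ fun q _ => ?_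
  rw [pow_two]
  refine Ideal.mul_mem_mul ?_ (hv _ _)
  rw [Matrix.mul_apply]
  exact Ideal.sum_mem _ fun p _ => I.mul_mem_right _ (hu _ _)

variable [Fintype ι]

lemma length_quotient_le_homologyLength {R : Type*} [CommRing R] [Nonempty ι] {A : Matrix ι ι R}
    {w : ι → ℕ} (hw : ∀ i j, w j ≤ w i → A i j = 0) {I : Ideal R} (hI : ∀ i j, A i j ∈ I) :
    Module.length R (R ⧸ I) ≤ homologyLength A.mulVecLin := by
  classical
  obtain ⟨i₀, hi₀⟩ := Finite.exists_min w
  have hcol : ∀ i, A i i₀ = 0 := fun i => hw _ _ (hi₀ i)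
  let f : R →ₗ[R] DiffHomology A.mulVecLin := (Submodule.mkQ _) ∘ₗ
    ((LinearMap.single R (fun _ : ι => R) i₀).codRestrict (LinearMap.ker A.mulVecLin) fun a => by
      rw [LinearMap.mem_ker]
      ext i
      simp [hcol])
  have hf : LinearMap.ker f ≤ I := by
    intro a ha
    rw [LinearMap.mem_ker, LinearMap.comp_apply, Submodule.mkQ_apply,
      Submodule.Quotient.mk_eq_zero] at ha
    obtain ⟨y, hy⟩ := ha
    have := congrFun hy i₀
    rw [Matrix.mulVecLin_apply] at this
    have h' : a = A.mulVec y i₀ := by simpa using this.symm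
    rw [h']
    exact Ideal.sum_mem _ fun j _ => I.mul_mem_right _ (hI _ _)
  calc Module.length R (R ⧸ I)
      ≤ Module.length R (R ⧸ LinearMap.ker f) :=
        Module.length_le_of_surjective (Submodule.factor hf) (Submodule.factor_surjective hf)
    _ = Module.length R (LinearMap.range f) := f.quotKerEquivRange.length_eq
    _ ≤ _ := Module.length_le_of_injective _ (Submodule.subtype_injective _)

/-- The squared differential: in characteristic two, over the ring with a generic parameter, a
triangular differential on a free module can be replaced by one of the same rank with entries in
the square of the ideal of entries, at the cost of a factor equal to the rank in the length of
homology. -/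
lemma exists_differential_sq {R : Type*} [CommRing R] [IsNoetherianRing R] (h2 : (2 : R) = 0)
    {A : Matrix ι ι R} (hA : A * A = 0) {w : ι → ℕ} (hw : ∀ i j, w j ≤ w i → A i j = 0)
    {I : Ideal R} (hI : ∀ i j, A i j ∈ I) :
    ∃ B : Matrix ι ι (GenericParameterRing R), B * B = 0 ∧ (∀ i j, w j ≤ w i → B i j = 0) ∧
      (∀ i j, B i j ∈ (I.map (algebraMap R (GenericParameterRing R))) ^ 2) ∧
      homologyLength B.mulVecLin ≤ Fintype.card ι * homologyLength A.mulVecLin := by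
  classical
  let _ : LinearOrder ι := linearOrderOfSTO WellOrderingRel
  set R' := GenericParameterRing R with hR'
  set T := tensorSquareMatrix A with hT
  set F := oneAddSwapMatrix R ι with hF
  set ΔP : Matrix (ι × ι) (ι × ι) R[X] := T.map C + (X : R[X]) • F.map C with hΔP
  have hΔPsq : ΔP * ΔP = 0 := by
    have h1 : T.map C * T.map C = (0 : Matrix _ _ R[X]) := by
      rw [← Matrix.map_mul, hT, tensorSquareMatrix_sq h2 hA, Matrix.map_zero _ (map_zero _)]
    have h3 : F.map C * F.map C = (0 : Matrix _ _ R[X]) := by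
      rw [← Matrix.map_mul, hF, oneAddSwapMatrix_sq h2, Matrix.map_zero _ (map_zero _)]
    have h4 : F.map C * T.map C = T.map C * F.map (C : R → R[X]) := by
      rw [← Matrix.map_mul, ← Matrix.map_mul, hF, hT, oneAddSwapMatrix_comm]
    have h5 (M : Matrix (ι × ι) (ι × ι) R[X]) : M + M = 0 := by
      rw [← two_smul R, h2, zero_smul]
    rw [hΔP, add_mul, mul_add, mul_add, smul_mul_assoc, smul_mul_assoc, mul_smul_comm,
      mul_smul_comm, h1, h3, h4, smul_zero, smul_zero, zero_add, add_zero, h5]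
  set Δ := ΔP.map (algebraMap R[X] R') with hΔ
  have hΔsq : Δ * Δ = 0 := by
    rw [hΔ, ← Matrix.map_mul, hΔPsq, Matrix.map_zero _ (map_zero _)]
  set t := algebraMap R[X] R' X with ht
  have hentry : ∀ p q, Δ p q = algebraMap R R' (T p q) + t * algebraMap R R' (F p q) := by
    intro p q
    rw [IsScalarTower.algebraMap_apply R R[X] R', IsScalarTower.algebraMap_apply R R[X] R',
      ht, ← map_mul, ← map_add]
    rfl
  have hFapp : ∀ p q, F p q = (if p = q then 1 else 0) + (if p.swap = q then 1 else 0) := by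
    intro p q
    rw [hF, oneAddSwapMatrix, Matrix.add_apply, Matrix.submatrix_apply, Matrix.one_apply,
      Matrix.one_apply]
    rfl
  set k : ι → ι × ι := fun i => (i, i) with hk
  set u : {p : ι × ι // p.1 < p.2} → ι × ι := fun p => p.1 with hu
  set v : {p : ι × ι // p.1 < p.2} → ι × ι := fun p => p.1.swap with hv
  have hTzero : ∀ {p q : ι × ι}, w q.1 + w q.2 ≤ w p.1 + w p.2 → T p q = 0 :=
    tensorSquareMatrix_eq_zero hw
  have hkk : ∀ i j, Δ (k i) (k j) = 0 := by
    intro i j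
    have h1 : F (k i) (k j) = 0 := by
      rw [hFapp]
      change (if (i, i) = (j, j) then (1 : R) else 0) + (if (i, i) = (j, j) then 1 else 0) = 0
      rw [← two_mul, h2, zero_mul]
    have h3 : T (k i) (k j) = 0 := by
      by_cases hij : i = j
      · subst hij
        exact hTzero le_rfl
      · rw [hT, tensorSquareMatrix_apply]
        simp [hk, hij]
    rw [hentry, h1, h3, map_zero, mul_zero, add_zero]
  have hku : ∀ i p, Δ (k i) (u p) = algebraMap R R' (T (k i) (u p)) := by
    rintro i ⟨⟨a, b⟩, hab⟩
    have h1 : F (k i) (a, b) = 0 := by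
      rw [hFapp]
      have : ¬ (i = a ∧ i = b) := fun h => hab.ne (h.1.symm.trans h.2)
      simp [hk, this]
    rw [hentry, h1, map_zero, mul_zero, add_zero]
  have hvk : ∀ p j, Δ (v p) (k j) = algebraMap R R' (T (v p) (k j)) := by
    rintro ⟨⟨a, b⟩, hab⟩ j
    have h1 : F (b, a) (k j) = 0 := by
      rw [hFapp]
      have h3 : ¬ (b = j ∧ a = j) := fun h => hab.ne (h.2.trans h.1.symm)
      have h4 : ¬ (a = j ∧ b = j) := fun h => h3 h.symm
      simp [hk, h3, h4]
    rw [hentry]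
    change _ + t * algebraMap R R' (F (b, a) (k j)) = _
    rw [h1, map_zero, mul_zero, add_zero]
  have hvu : ∀ p q, Δ (v p) (u q) =
      algebraMap R R' (T (v p) (u q)) + if p = q then t else 0 := by
    rintro ⟨⟨a, b⟩, hab⟩ ⟨⟨c, d⟩, hcd⟩
    have h1 : F (b, a) (c, d) = if (a, b) = (c, d) then 1 else 0 := by
      rw [hFapp, if_neg, zero_add]
      · rfl
      · rintro h
        rw [Prod.mk.injEq] at h
        obtain ⟨rfl, rfl⟩ := h
        exact absurd hab hcd.asymm
    rw [hentry]
    change _ + t * algebraMap R R' (F (b, a) (c, d)) = _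
    rw [h1]
    simp only [Subtype.mk.injEq]
    split_ifs <;> simp
  let b : {p : ι × ι // p.1 < p.2} → ℕ := fun p => w p.1.1 + w p.1.2
  have hΘ : ∀ p q, b q ≤ b p → Δ.submatrix v u p q = if p = q then t else 0 := by
    intro p q h
    rw [Matrix.submatrix_apply, hvu, hTzero, map_zero, zero_add]
    change w q.1.1 + w q.1.2 ≤ w p.1.2 + w p.1.1
    rw [add_comm (w p.1.2)]
    exact h
  have hblock : (Δ.submatrix v u).BlockTriangular b := fun p q h => by
    rw [hΘ p q h.le, if_neg]
    rintro rfl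
    exact lt_irrefl _ h
  have hdet : IsUnit (Δ.submatrix v u).det := by
    rw [hblock.det, IsUnit.prod_iff]
    intro a _
    have : (Δ.submatrix v u).toSquareBlock b a = t • 1 := by
      ext p q
      rw [Matrix.toSquareBlock_def, Matrix.of_apply, hΘ _ _ (q.2.trans p.2.symm).le]
      simp [Matrix.one_apply, Subtype.ext_iff]
    rw [this, Matrix.det_smul, Matrix.det_one, mul_one]
    exact isUnit_algebraMap_X.pow _
  have hinv : (Δ.submatrix v u)⁻¹.BlockTriangular b := by
    let _ := Matrix.invertibleOfIsUnitDet _ hdet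
    exact Matrix.blockTriangular_inv_of_blockTriangular hblock
  refine ⟨eliminationMatrix Δ k u v, eliminationMatrix_sq hΔsq bijective_diag_lt_gt hdet, ?_, ?_,
    ?_⟩
  · intro i j hij
    rw [eliminationMatrix, Matrix.sub_apply, Matrix.submatrix_apply, hkk, zero_sub, neg_eq_zero,
      Matrix.mul_apply]
    refine Finset.sum_eq_zero fun q _ => ?_
    by_cases hq : w j + w j ≤ b q
    · rw [Matrix.submatrix_apply, hvk, hTzero, map_zero, mul_zero]
      change _ ≤ w q.1.2 + w q.1.1
      rw [add_comm (w q.1.2)]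
      exact hq
    · rw [Matrix.mul_apply, Finset.sum_eq_zero, zero_mul]
      intro p _
      by_cases hp : b p ≤ w i + w i
      · rw [Matrix.submatrix_apply, hku, hTzero hp, map_zero, zero_mul]
      · rw [hinv (by omega), mul_zero]
  · exact eliminationMatrix_mem hkk
      (fun i p => by rw [hku]; exact Ideal.mem_map_of_mem _ (tensorSquareMatrix_mem hI _ _))
      (fun p j => by rw [hvk]; exact Ideal.mem_map_of_mem _ (tensorSquareMatrix_mem hI _ _))
  · exact (homologyLength_eliminationMatrix_le hΔsq bijective_diag_lt_gt hdet).trans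
      ((homologyLength_generic_le T F hΔPsq).trans (homologyLength_tensorSquareMatrix_le h2 hA hw))

lemma length_quotient_pow_le [Nonempty ι] {w : ι → ℕ} (n : ℕ) :
    ∀ {R : Type*} [CommRing R] [IsNoetherianRing R] (_ : (2 : R) = 0)
      {A : Matrix ι ι R} (_ : A * A = 0) (_ : ∀ i j, w j ≤ w i → A i j = 0)
      {I : Ideal R} (_ : ∀ i j, A i j ∈ I),
      Module.length R (R ⧸ I ^ 2 ^ n) ≤ Fintype.card ι ^ n * homologyLength A.mulVecLin := by
  induction n with
  | zero =>
    intro R _ _ _ A _ hw I hI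
    rw [pow_zero, pow_zero, pow_one, one_mul]
    exact length_quotient_le_homologyLength hw hI
  | succ n ih =>
    intro R _ _ h2 A hA hw I hI
    obtain ⟨B, hB, hwB, hIB, hle⟩ := exists_differential_sq h2 hA hw hI
    have hN : IsNoetherianRing (GenericParameterRing R) :=
      IsLocalization.isNoetherianRing (lowestCoeffOneSubmonoid R) _ inferInstance
    have h2' : (2 : GenericParameterRing R) = 0 := by
      rw [← map_ofNat (algebraMap R (GenericParameterRing R)) 2, h2, map_zero]
    have := ih h2' hB hwB hIB
    rw [← pow_mul, ← pow_succ', ← Ideal.map_pow] at this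
    refine (length_quotient_le_length_quotient_map _).trans (this.trans ?_)
    rw [pow_succ, mul_assoc]
    gcongr

end FrobeniusTwist

section LengthGrowth

variable {R : Type*} [CommRing R]

lemma length_quotient_add_length_quotient_le {K K₁ K₂ : Ideal R} {x : R} (hK : K ≤ K₂)
    (hx : x ∈ K₂) (h : ∀ y, x * y ∈ K → y ∈ K₁) :
    Module.length R (R ⧸ K₁) + Module.length R (R ⧸ K₂) ≤ Module.length R (R ⧸ K) := by
  let f : R →ₗ[R] R ⧸ K := K.mkQ ∘ₗ LinearMap.mulLeft R x
  have hf : LinearMap.ker f ≤ K₁ := fun y hy => by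
    refine h y ?_
    rwa [LinearMap.mem_ker, LinearMap.comp_apply, Submodule.mkQ_apply,
      Submodule.Quotient.mk_eq_zero] at hy
  have h₁ : Module.length R (R ⧸ K₁) ≤ Module.length R (LinearMap.range f) := by
    rw [← f.quotKerEquivRange.length_eq]
    exact Module.length_le_of_surjective (Submodule.factor hf) (Submodule.factor_surjective hf)
  have hle : LinearMap.range f ≤ LinearMap.ker (Submodule.factor hK) := by
    rintro _ ⟨y, rfl⟩
    rw [LinearMap.mem_ker]
    change Submodule.factor hK (Submodule.Quotient.mk (x * y)) = 0
    rw [← Submodule.mkQ_apply, Submodule.factor_mk, Submodule.mkQ_apply,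
      Submodule.Quotient.mk_eq_zero]
    exact K₂.mul_mem_right _ hx
  have h₂ : Module.length R (R ⧸ K₂) ≤ Module.length R ((R ⧸ K) ⧸ LinearMap.range f) := by
    refine Module.length_le_of_surjective (Submodule.liftQ _ (Submodule.factor hK) hle) ?_
    intro z
    obtain ⟨y, rfl⟩ := Submodule.factor_surjective hK z
    exact ⟨Submodule.Quotient.mk y, rfl⟩
  rw [Module.length_eq_add_of_exact (LinearMap.range f).subtype (LinearMap.range f).mkQ
    (Submodule.subtype_injective _) (Submodule.mkQ_surjective _)
    (LinearMap.exact_subtype_mkQ _)]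
  exact add_le_add h₁ h₂

lemma exists_colon_sup_pow_le [IsNoetherianRing R] (m p : Ideal R) [p.IsPrime] {x : R}
    (hx : x ∉ p) : ∃ a, ∀ n y, x * y ∈ p ⊔ m ^ (n + a) → y ∈ p ⊔ m ^ n := by
  obtain ⟨a, ha⟩ := m.exists_pow_inf_eq_pow_smul
    (Submodule.span R {(Submodule.Quotient.mk x : R ⧸ p)})
  refine ⟨a, fun n y hy => ?_⟩
  obtain ⟨b, hb, c, hc, hbc⟩ := Submodule.mem_sup.1 hy
  have hmem : (Submodule.Quotient.mk (x * y) : R ⧸ p) ∈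
      m ^ (n + a) • (⊤ : Submodule R (R ⧸ p)) ⊓
        Submodule.span R {(Submodule.Quotient.mk x : R ⧸ p)} := by
    refine ⟨?_, Submodule.mem_span_singleton.2 ⟨y, ?_⟩⟩
    · have : (Submodule.Quotient.mk (x * y) : R ⧸ p) = c • Submodule.Quotient.mk 1 := by
        rw [← Submodule.Quotient.mk_smul, Submodule.Quotient.eq, smul_eq_mul, mul_one, ← hbc,
          add_sub_cancel_right]
        exact hb
      rw [this]
      exact Submodule.smul_mem_smul hc trivial
    · rw [← Submodule.Quotient.mk_smul, smul_eq_mul, mul_comm]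
  rw [ha _ (Nat.le_add_left _ _), Nat.add_sub_cancel] at hmem
  obtain ⟨z, hz, hzx⟩ := Submodule.mem_smul_span_singleton.1
    (Submodule.smul_mono le_rfl inf_le_right hmem)
  rw [← Submodule.Quotient.mk_smul, Submodule.Quotient.eq, smul_eq_mul, mul_comm z,
    ← mul_sub] at hzx
  have := (Ideal.IsPrime.mem_or_mem ‹_› hzx).resolve_left hx
  rw [← sub_sub_self z y]
  exact Submodule.sub_mem _ (Submodule.mem_sup_right hz) (Submodule.mem_sup_left this)

lemma succ_pow_succ_le (q k : ℕ) : (q + 1) ^ (k + 1) ≤ q ^ (k + 1) + (k + 1) * (q + 1) ^ k := by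
  induction k with
  | zero => simp
  | succ k ih =>
    have h1 : q ^ (k + 1) ≤ (q + 1) ^ (k + 1) := Nat.pow_le_pow_left (Nat.le_succ _) _
    calc (q + 1) ^ (k + 1 + 1) = (q + 1) ^ (k + 1) * (q + 1) := pow_succ _ _
      _ ≤ (q ^ (k + 1) + (k + 1) * (q + 1) ^ k) * (q + 1) := Nat.mul_le_mul_right _ ih
      _ = q ^ (k + 1 + 1) + q ^ (k + 1) + (k + 1) * (q + 1) ^ (k + 1) := by ring
      _ ≤ q ^ (k + 1 + 1) + (q + 1) ^ (k + 1) + (k + 1) * (q + 1) ^ (k + 1) := by gcongr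
      _ = _ := by ring

/-- The colengths of the powers of the maximal ideal in the quotient by a prime ideal grow at
least like a polynomial of degree the length of any chain of primes starting there. -/
lemma exists_pow_le_length_quotient_sup_pow [IsNoetherianRing R] [IsLocalRing R]
    (l : LTSeries (PrimeSpectrum R)) (i : Fin (l.length + 1)) :
    ∃ s c : ℕ, 0 < s ∧ ∀ q : ℕ, 0 < q → ((q ^ (l.length - i) : ℕ) : ℕ∞) ≤
      c * Module.length R (R ⧸ (l i).asIdeal ⊔ IsLocalRing.maximalIdeal R ^ (s * q)) := by
  induction i using Fin.reverseInduction with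
  | last =>
    refine ⟨1, 1, one_pos, fun q hq => ?_⟩
    have : Nontrivial (R ⧸ (l (Fin.last _)).asIdeal ⊔ IsLocalRing.maximalIdeal R ^ (1 * q)) := by
      refine Ideal.Quotient.nontrivial_iff.2 (ne_top_of_le_ne_top
        (IsLocalRing.maximalIdeal.isMaximal R).ne_top (sup_le ?_ ?_))
      · exact IsLocalRing.le_maximalIdeal (l _).isPrime.ne_top
      · exact Ideal.pow_le_self (by omega)
    simpa [Order.one_le_iff_pos, Module.length_pos_iff] using this
  | cast i ih =>
    obtain ⟨s, c, hs, h⟩ := ih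
    have hlt : (l i.castSucc).asIdeal < (l i.succ).asIdeal := l.step i
    obtain ⟨x, hx', hx⟩ := SetLike.exists_of_lt hlt
    obtain ⟨a, ha⟩ := exists_colon_sup_pow_le (IsLocalRing.maximalIdeal R) _ hx
    obtain ⟨k, hk⟩ : ∃ k, l.length - (i.succ : ℕ) = k := ⟨_, rfl⟩
    have hk' : l.length - (i.castSucc : ℕ) = k + 1 := by
      have := i.2
      simp only [Fin.val_succ, Fin.val_castSucc] at hk ⊢
      omega
    rw [hk] at h
    rw [hk']
    have hmono : a ≤ s * (a + 1) := by nlinarith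
    refine ⟨s * (a + 1), (k + 1) * c, by positivity, fun q _ => ?_⟩
    induction q with
    | zero => simp
    | succ q ih =>
      have hadd := length_quotient_add_length_quotient_le
        (K := (l i.castSucc).asIdeal ⊔ IsLocalRing.maximalIdeal R ^ (s * (a + 1) * (q + 1)))
        (K₁ := (l i.castSucc).asIdeal ⊔ IsLocalRing.maximalIdeal R ^ (s * (a + 1) * q))
        (K₂ := (l i.succ).asIdeal ⊔ IsLocalRing.maximalIdeal R ^ (s * (a + 1) * (q + 1)))
        (sup_le_sup_right hlt.le _) (Submodule.mem_sup_left hx') fun y hy =>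
          ha _ y ((sup_le_sup_left (Ideal.pow_le_pow_right
            (by rw [mul_add_one (s * (a + 1))]; exact Nat.add_le_add_left hmono _)) _ :
              _ ≤ (l i.castSucc).asIdeal ⊔ _) hy)
      have hq := h ((a + 1) * (q + 1)) (by positivity)
      rw [← mul_assoc] at hq
      have hq' : (((q + 1) ^ k : ℕ) : ℕ∞) ≤ (((a + 1) * (q + 1)) ^ k : ℕ) := by
        exact_mod_cast Nat.pow_le_pow_left (Nat.le_mul_of_pos_left _ (Nat.succ_pos a)) k
      have ih' : ((q ^ (k + 1) : ℕ) : ℕ∞) ≤ ((k + 1) * c : ℕ) * Module.length R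
          (R ⧸ (l i.castSucc).asIdeal ⊔ IsLocalRing.maximalIdeal R ^ (s * (a + 1) * q)) := by
        rcases q.eq_zero_or_pos with rfl | h0
        · simp
        · exact ih h0
      calc (((q + 1) ^ (k + 1) : ℕ) : ℕ∞)
          ≤ ((q ^ (k + 1) + (k + 1) * (q + 1) ^ k : ℕ) : ℕ∞) := by
            exact_mod_cast succ_pow_succ_le q k
        _ = ((q ^ (k + 1) : ℕ) : ℕ∞) + ((k + 1 : ℕ) : ℕ∞) * (((q + 1) ^ k : ℕ) : ℕ∞) := by
            push_cast; rfl
        _ ≤ _ := add_le_add ih' (mul_le_mul_right (hq'.trans hq) _)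
        _ = _ := by rw [Nat.cast_mul, ← mul_assoc _ (c : ℕ∞), ← mul_add]
        _ ≤ _ := mul_le_mul_right hadd _

lemma pow_mul_add_le_succ_pow_mul (r n : ℕ) : r ^ n * (r + n) ≤ (r + 1) ^ n * r := by
  induction n with
  | zero => simp
  | succ n ih =>
    calc r ^ (n + 1) * (r + (n + 1)) ≤ r ^ n * (r + n) * (r + 1) := by
          rw [pow_succ, mul_assoc, mul_assoc]
          exact Nat.mul_le_mul_left _ (by nlinarith)
      _ ≤ (r + 1) ^ n * r * (r + 1) := Nat.mul_le_mul_right _ ih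
      _ = _ := by ring

lemma le_of_forall_pow_le_mul_pow {a r K : ℕ} (h : ∀ n, a ^ n ≤ K * r ^ n) : a ≤ r := by
  by_contra! hlt
  rcases r.eq_zero_or_pos with rfl | hr
  · simpa [hlt.ne'] using h 1
  · have h1 : (r + 1) ^ (K * r) ≤ K * r ^ (K * r) := (Nat.pow_le_pow_left hlt _).trans (h _)
    have h2 := (pow_mul_add_le_succ_pow_mul r (K * r)).trans (Nat.mul_le_mul_right r h1)
    rw [mul_comm K (r ^ _), mul_assoc] at h2
    have := Nat.le_of_mul_le_mul_left h2 (Nat.pow_pos hr)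
    omega

lemma two_pow_le_of_length_quotient_pow_le [IsNoetherianRing R] [IsLocalRing R] {e r : ℕ} {C : ℕ∞}
    (he : e ≤ ringKrullDim R) (hC : C ≠ ⊤) (h : ∀ n, Module.length R
      (R ⧸ IsLocalRing.maximalIdeal R ^ 2 ^ n) ≤ (r : ℕ∞) ^ n * C) : 2 ^ e ≤ r := by
  obtain ⟨l, rfl⟩ := Order.le_krullDim_iff.1 he
  obtain ⟨s, c, -, hl⟩ := exists_pow_le_length_quotient_sup_pow l 0
  lift C to ℕ using hC
  obtain ⟨t, ht⟩ : ∃ t, s ≤ 2 ^ t := ⟨s, Nat.lt_two_pow_self.le⟩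
  refine le_of_forall_pow_le_mul_pow (K := c * (r ^ t * C)) fun n => ?_
  have hle : IsLocalRing.maximalIdeal R ^ 2 ^ (n + t) ≤
      (l 0).asIdeal ⊔ IsLocalRing.maximalIdeal R ^ (s * 2 ^ n) :=
    (Ideal.pow_le_pow_right (by rw [pow_add, mul_comm]; gcongr)).trans le_sup_right
  have := (hl (2 ^ n) (by positivity)).trans (mul_le_mul_right
    ((Module.length_le_of_surjective (Submodule.factor hle)
      (Submodule.factor_surjective hle)).trans (h (n + t))) _)
  have h' : (2 ^ n) ^ l.length ≤ c * (r ^ (n + t) * C) := by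
    simpa only [Fin.val_zero, Nat.sub_zero] using (by exact_mod_cast this)
  calc (2 ^ l.length) ^ n = (2 ^ n) ^ l.length := by rw [← pow_mul, ← pow_mul, mul_comm]
    _ ≤ _ := h'
    _ = _ := by ring

end LengthGrowth

section LocalFiniteLength

variable {R : Type*} [CommRing R] [IsLocalRing R] {M : Type*} [AddCommGroup M] [Module R M]

lemma isFiniteLength_of_forall_exists_pow_smul_eq_zero [IsNoetherianRing R] [Module.Finite R M]
    (h : ∀ a ∈ IsLocalRing.maximalIdeal R, ∃ n : ℕ, ∀ x : M, a ^ n • x = 0) :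
    IsFiniteLength R M := by
  have hdim : Ring.KrullDimLE 0 (R ⧸ Module.annihilator R M) := by
    refine Ideal.krullDimLE_zero_quotient_iff_forall_minimalPrimes_isMaximal.2 fun J hJ => ?_
    have hJp : J.IsPrime := hJ.1.1
    have hle : IsLocalRing.maximalIdeal R ≤ J := fun a ha => by
      obtain ⟨n, hn⟩ := h a ha
      exact hJp.mem_of_pow_mem n (hJ.1.2 (Module.mem_annihilator.2 hn))
    rw [← (IsLocalRing.maximalIdeal.isMaximal R).eq_of_le hJp.ne_top hle]
    infer_instance
  have : IsArtinianRing (R ⧸ Module.annihilator R M) := isArtinianRing_iff_krullDimLE_zero.2 hdim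
  let _ : Module (R ⧸ Module.annihilator R M) M := Module.quotientAnnihilator
  have : IsScalarTower R (R ⧸ Module.annihilator R M) M :=
    (Module.isTorsionBySet_annihilator R M).isScalarTower
  have : Module.Finite (R ⧸ Module.annihilator R M) M := .of_restrictScalars_finite R _ _
  have : IsArtinian R M := by
    have : IsArtinian (R ⧸ Module.annihilator R M) M := inferInstance
    exact isArtinian_of_surjective_algebraMap (R := R ⧸ Module.annihilator R M)
      Ideal.Quotient.mk_surjective
  exact isFiniteLength_iff_isNoetherian_isArtinian.2 ⟨inferInstance, this⟩

lemma IsFiniteLength.exists_pow_smul_eq_zero (h : IsFiniteLength R M) {a : R}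
    (ha : a ∈ IsLocalRing.maximalIdeal R) : ∃ n : ℕ, ∀ x : M, a ^ n • x = 0 := by
  obtain ⟨_, _⟩ := isFiniteLength_iff_isNoetherian_isArtinian.1 h
  obtain ⟨n, hn⟩ := IsArtinian.range_smul_pow_stabilizes M a
  have := Submodule.eq_bot_of_le_smul_of_le_jacobson_bot (Ideal.span {a})
    (LinearMap.range (a ^ n • (LinearMap.id : M →ₗ[R] M))) (IsNoetherian.noetherian _) (by
      refine (hn (n + 1) (Nat.le_succ n)).le.trans ?_
      rintro _ ⟨x, rfl⟩
      rw [LinearMap.smul_apply, LinearMap.id_apply, pow_succ', mul_smul]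
      exact Submodule.smul_mem_smul (Ideal.mem_span_singleton_self a) ⟨x, rfl⟩)
    (by
      rw [IsLocalRing.jacobson_eq_maximalIdeal _ bot_ne_top]
      exact (Ideal.span_singleton_le_iff_mem _).2 ha)
  refine ⟨n, fun x => ?_⟩
  have hx : a ^ n • x ∈ LinearMap.range (a ^ n • (LinearMap.id : M →ₗ[R] M)) := ⟨x, rfl⟩
  rwa [this, Submodule.mem_bot] at hx

end LocalFiniteLength

section Homotopy

variable {ι : Type*} [Fintype ι] {R : Type*} [CommRing R] {A : Matrix ι ι R}

lemma exists_homotopy [DecidableEq ι] (hA : A * A = 0) {w : ι → ℕ}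
    (hw : ∀ i j, w j ≤ w i → A i j = 0) {a : R}
    (ha : ∀ x, A.mulVec x = 0 → ∃ y, a • x = A.mulVec y) :
    ∃ (n : ℕ) (h : Matrix ι ι R), a ^ n • (1 : Matrix ι ι R) = A * h + h * A := by
  have key : ∀ k : ℕ, ∃ h : Matrix ι ι R, ∀ j, w j < k → ∀ i,
      (a ^ k • (1 : Matrix ι ι R) - (A * h + h * A)) i j = 0 := by
    intro k
    induction k with
    | zero => exact ⟨0, fun j hj => absurd hj (Nat.not_lt_zero _)⟩
    | succ k ih =>
      obtain ⟨h, hh⟩ := ih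
      set g := a ^ k • (1 : Matrix ι ι R) - (A * h + h * A) with hg
      have hcomm : A * g = g * A := by
        simp only [hg, mul_sub, sub_mul, mul_add, add_mul, ← mul_assoc, hA]
        simp [mul_assoc, hA]
      have hy : ∀ j, ∃ y : ι → R, (w j ≠ k → y = 0) ∧
          (w j ≤ k → ∀ i, a * g i j = ∑ l, A i l * y l) := by
        intro j
        rcases lt_trichotomy (w j) k with hj | hj | hj
        · exact ⟨0, fun _ => rfl, fun _ i => by simp [hh j hj i]⟩
        · obtain ⟨y, hy⟩ := ha (fun i => g i j) (by
            ext i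
            change (A * g) i j = 0
            rw [hcomm, Matrix.mul_apply]
            refine Finset.sum_eq_zero fun l _ => ?_
            by_cases hl : w j ≤ w l
            · rw [hw _ _ hl, mul_zero]
            · rw [hh l (by omega), zero_mul])
          exact ⟨y, fun h' => absurd hj h', fun _ i => congrFun hy i⟩
        · exact ⟨0, fun _ => rfl, fun h' => absurd hj h'.not_gt⟩
      choose y hy0 hy using hy
      refine ⟨a • h + Matrix.of fun i j => y j i, fun j hj i => ?_⟩
      have h1 : a ^ (k + 1) • (1 : Matrix ι ι R) - (A * (a • h + Matrix.of fun i j => y j i) +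
          (a • h + Matrix.of fun i j => y j i) * A) =
          a • g - A * (Matrix.of fun i j => y j i) - (Matrix.of fun i j => y j i) * A := by
        rw [hg, mul_add, add_mul, mul_smul_comm, smul_mul_assoc, smul_sub, smul_add, smul_smul,
          pow_succ']
        abel
      have h2 : (A * Matrix.of fun i j => y j i) i j = a * g i j := by
        rw [hy j (by omega), Matrix.mul_apply]
        rfl
      have h3 : ((Matrix.of fun i j => y j i) * A) i j = 0 := by
        rw [Matrix.mul_apply]
        refine Finset.sum_eq_zero fun l _ => ?_
        by_cases hl : w j ≤ w l
        · rw [hw _ _ hl, mul_zero]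
        · rw [Matrix.of_apply, hy0 l (by omega), Pi.zero_apply, zero_mul]
      rw [h1, Matrix.sub_apply, Matrix.sub_apply, h2, h3, Matrix.smul_apply, smul_eq_mul, sub_self,
        sub_zero]
  obtain ⟨h, hh⟩ := key (Finset.univ.sup w + 1)
  refine ⟨Finset.univ.sup w + 1, h, ?_⟩
  ext i j
  exact sub_eq_zero.1 (hh j (Nat.lt_succ_of_le (Finset.le_sup (Finset.mem_univ j))) i)

lemma exists_pow_smul_eq_mulVec_map {S : Type*} [CommRing S] (f : R →+* S) (hA : A * A = 0)
    {w : ι → ℕ} (hw : ∀ i j, w j ≤ w i → A i j = 0) {a : R}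
    (ha : ∀ x, A.mulVec x = 0 → ∃ y, a • x = A.mulVec y) :
    ∃ n : ℕ, ∀ x, (A.map f).mulVec x = 0 → ∃ y, f a ^ n • x = (A.map f).mulVec y := by
  classical
  obtain ⟨n, h, hh⟩ := exists_homotopy hA hw ha
  have hmap : f a ^ n • (1 : Matrix ι ι S) = A.map f * h.map f + h.map f * A.map f := by
    rw [← Matrix.map_mul, ← Matrix.map_mul, ← Matrix.map_add f (map_add f), ← hh, ← map_pow]
    ext i j
    simp [Matrix.one_apply, apply_ite f]
  refine ⟨n, fun x hx => ⟨(h.map f).mulVec x, ?_⟩⟩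
  have := congrArg (fun B => B.mulVec x) hmap
  simpa [Matrix.add_mulVec, ← Matrix.mulVec_mulVec, hx, Matrix.smul_mulVec] using this

lemma homologyLength_ne_top [IsNoetherianRing R] [IsLocalRing R]
    (h : ∀ a ∈ IsLocalRing.maximalIdeal R, ∃ n : ℕ, ∀ x, A.mulVec x = 0 →
      ∃ y, a ^ n • x = A.mulVec y) : homologyLength A.mulVecLin ≠ ⊤ := by
  refine Module.length_ne_top_iff.2 (isFiniteLength_of_forall_exists_pow_smul_eq_zero
    fun a ha => ?_)
  obtain ⟨n, hn⟩ := h a ha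
  refine ⟨n, fun q => ?_⟩
  obtain ⟨⟨x, hx⟩, rfl⟩ := Submodule.Quotient.mk_surjective _ q
  obtain ⟨y, hy⟩ := hn x hx
  rw [← Submodule.Quotient.mk_smul, Submodule.Quotient.mk_eq_zero]
  exact ⟨y, hy.symm⟩

end Homotopy

section TinyDifferential

universe u

variable {R : Type*} [CommRing R]

/-- A matrix `A` is a tiny differential for the grading `w` of the standard basis if it is a
differential of degree `-1` whose homology is nonzero and annihilated by a power of each
nonunit. -/
structure IsTinyDifferential {ι : Type*} [Fintype ι] (A : Matrix ι ι R) (w : ι → ℕ) : Prop where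
  sq_eq_zero : A * A = 0
  degree : ∀ i j, A i j ≠ 0 → w i + 1 = w j
  exists_pow_smul_eq : ∀ a ∈ nonunits R, ∃ n : ℕ, ∀ x, A.mulVec x = 0 →
    ∃ y, a ^ n • x = A.mulVec y
  exists_ne : ∃ x, A.mulVec x = 0 ∧ ∀ y, x ≠ A.mulVec y

lemma IsTinyDifferential.exists_isTinyDifferential_of_isUnit {ι : Type*} [Fintype ι] [Nontrivial R]
    {A : Matrix ι ι R} {w : ι → ℕ} (hA : IsTinyDifferential A w) {i₀ j₀ : ι}
    (h : IsUnit (A i₀ j₀)) :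
    ∃ (S : Set ι) (_ : Fintype S) (B : Matrix S S R), Fintype.card S < Fintype.card ι ∧
      IsTinyDifferential B fun i => w i := by
  classical
  have hne : w i₀ + 1 = w j₀ := hA.degree _ _ h.ne_zero
  have hij : i₀ ≠ j₀ := by
    rintro rfl
    omega
  let S : Set ι := {i | i ≠ j₀ ∧ i ≠ i₀}
  let k : S → ι := Subtype.val
  let u : Unit → ι := fun _ => j₀
  let v : Unit → ι := fun _ => i₀
  have hbij : Function.Bijective (Sum.elim k (Sum.elim u v)) := by
    constructor
    · rintro (⟨i, hi⟩ | _ | _) (⟨j, hj⟩ | _ | _) heq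
      · exact congrArg Sum.inl (Subtype.ext heq)
      · exact absurd heq hi.1
      · exact absurd heq hi.2
      · exact absurd heq.symm hj.1
      · rfl
      · exact absurd heq.symm hij
      · exact absurd heq.symm hj.2
      · exact absurd heq hij
      · rfl
    · intro i
      by_cases h1 : i = j₀
      · exact ⟨Sum.inr (Sum.inl ()), h1.symm⟩
      by_cases h2 : i = i₀
      · exact ⟨Sum.inr (Sum.inr ()), h2.symm⟩
      · exact ⟨Sum.inl ⟨i, h1, h2⟩, rfl⟩
  have hdet : IsUnit (A.submatrix v u).det := by
    rw [Matrix.det_unique]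
    exact h
  obtain ⟨inc, -, hchain, hbd, hcyc⟩ := exists_eliminationMap hA.sq_eq_zero hbij hdet
  refine ⟨S, inferInstance, eliminationMatrix A k u v, Fintype.card_subtype_lt (x := i₀) ?_,
    eliminationMatrix_sq hA.sq_eq_zero hbij hdet, ?_, ?_, ?_⟩
  · exact fun h' => h'.2 rfl
  · intro i j hB
    by_cases h1 : A i j = 0
    · have h2 : A i j₀ ≠ 0 ∧ A i₀ j ≠ 0 := by
        constructor <;> intro h' <;> refine hB ?_ <;>
          simp [eliminationMatrix, Matrix.mul_apply, k, u, v, h1, h']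
      have h3 := hA.degree _ _ h2.1
      have h4 := hA.degree _ _ h2.2
      omega
    · exact hA.degree _ _ h1
  · intro a ha
    obtain ⟨n, hn⟩ := hA.exists_pow_smul_eq a ha
    refine ⟨n, fun x hx => ?_⟩
    obtain ⟨y, hy⟩ := hn (inc x) (by rw [hchain, hx, map_zero])
    exact hbd _ y (by rw [map_smul, hy])
  · obtain ⟨y, hy, hy'⟩ := hA.exists_ne
    obtain ⟨x, z, hx, rfl⟩ := hcyc y hy
    refine ⟨x, hx, ?_⟩
    rintro z' rfl
    exact hy' (inc z' + z) (by rw [Matrix.mulVec_add, hchain])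

/-- A tiny differential can be replaced by a minimal one of no larger rank. -/
lemma IsTinyDifferential.exists_minimal [Nontrivial R] (n : ℕ) {ι : Type u} [Fintype ι]
    {A : Matrix ι ι R} {w : ι → ℕ} (hA : IsTinyDifferential A w) (hn : Fintype.card ι = n) :
    ∃ (κ : Type u) (_ : Fintype κ) (B : Matrix κ κ R) (w' : κ → ℕ),
      Fintype.card κ ≤ n ∧ IsTinyDifferential B w' ∧ ∀ i j, B i j ∈ nonunits R := by
  induction n using Nat.strong_induction_on generalizing ι with
  | _ n ih =>
    by_cases h : ∀ i j, A i j ∈ nonunits R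
    · exact ⟨ι, inferInstance, A, w, hn.le, hA, h⟩
    · simp only [mem_nonunits_iff, not_forall, not_not] at h
      obtain ⟨i₀, j₀, h⟩ := h
      obtain ⟨S, _, B, hlt, hB⟩ := hA.exists_isTinyDifferential_of_isUnit h
      obtain ⟨κ, _, C, w', hle, hC⟩ := ih _ (hn ▸ hlt) hB rfl
      exact ⟨κ, inferInstance, C, w', hle.trans (hn ▸ hlt.le), hC⟩

theorem IsTinyDifferential.two_pow_le_card [IsNoetherianRing R] [IsLocalRing R] {ι : Type*}
    [Fintype ι] {A : Matrix ι ι R} {w : ι → ℕ} (hA : IsTinyDifferential A w)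
    (h2 : (2 : R) ∈ IsLocalRing.maximalIdeal R) {e : ℕ}
    (he : e ≤ ringKrullDim (R ⧸ Ideal.span {(2 : R)})) : 2 ^ e ≤ Fintype.card ι := by
  obtain ⟨κ, _, B, w', hle, hB, hmem⟩ := hA.exists_minimal _ rfl
  refine le_trans ?_ hle
  have hκ : Nonempty κ := by
    by_contra hκ
    rw [not_nonempty_iff] at hκ
    obtain ⟨x, -, hx⟩ := hB.exists_ne
    exact hx 0 (Subsingleton.elim _ _)
  set f := Ideal.Quotient.mk (Ideal.span {(2 : R)}) with hf
  have hfs : Function.Surjective f := Ideal.Quotient.mk_surjective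
  have : Nontrivial (R ⧸ Ideal.span {(2 : R)}) := by
    refine Ideal.Quotient.nontrivial_iff.2 (ne_top_of_le_ne_top
      (IsLocalRing.maximalIdeal.isMaximal R).ne_top ?_)
    exact (Ideal.span_singleton_le_iff_mem _).2 h2
  have : IsLocalRing (R ⧸ Ideal.span {(2 : R)}) := IsLocalRing.of_surjective' f hfs
  have : IsLocalHom f := IsLocalHom.of_surjective f hfs
  have hw : ∀ i j, w' j ≤ w' i → B i j = 0 := fun i j hij => by
    by_contra h
    have := hB.degree i j h
    omega
  have h2' : (2 : R ⧸ Ideal.span {(2 : R)}) = 0 := by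
    rw [← map_ofNat f 2]
    exact Ideal.Quotient.eq_zero_iff_mem.2 (Ideal.mem_span_singleton_self 2)
  have hC : homologyLength (B.map f).mulVecLin ≠ ⊤ := by
    refine homologyLength_ne_top fun a ha => ?_
    obtain ⟨a, rfl⟩ := hfs a
    obtain ⟨n, hn⟩ := hB.exists_pow_smul_eq a fun h => ha (h.map f)
    obtain ⟨n', hn'⟩ := exists_pow_smul_eq_mulVec_map f hB.sq_eq_zero hw hn
    refine ⟨n * n', ?_⟩
    simpa only [map_pow, ← pow_mul] using hn'
  refine two_pow_le_of_length_quotient_pow_le he hC fun n =>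
    length_quotient_pow_le (w := w') n h2' ?_ ?_ ?_
  · rw [← Matrix.map_mul, hB.sq_eq_zero, Matrix.map_zero _ (map_zero f)]
  · intro i j hij
    rw [Matrix.map_apply, hw i j hij, map_zero]
  · intro i j h
    exact hmem i j (isUnit_of_map_unit f _ h)

end TinyDifferential

section ChainComplexHomology

variable {R : Type*} [CommRing R] (P : ChainComplex (ModuleCat R) ℕ)

/-- The homology of a chain complex of modules as a quotient of the module of cycles. -/
noncomputable def chainHomologyEquiv (i : ℕ) :
    P.homology i ≃ₗ[R]
      LinearMap.ker (P.sc' (i + 1) i ((ComplexShape.down ℕ).next i)).g.hom ⧸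
        LinearMap.range (P.sc' (i + 1) i ((ComplexShape.down ℕ).next i)).moduleCatToCycles :=
  ((ShortComplex.homologyMapIso (P.isoSc' (i + 1) i _ (ChainComplex.prev ℕ i) rfl)) ≪≫
    (P.sc' (i + 1) i _).moduleCatHomologyIso).toLinearEquiv

lemma exists_pow_smul_eq_d_of_isFiniteLength [IsLocalRing R] {i : ℕ}
    (h : IsFiniteLength R (P.homology i)) {a : R} (ha : a ∈ IsLocalRing.maximalIdeal R) :
    ∃ n : ℕ, ∀ z : P.X i, (∀ j, P.d i j z = 0) →
      ∃ y : P.X (i + 1), a ^ n • z = P.d (i + 1) i y := by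
  obtain ⟨n, hn⟩ := h.exists_pow_smul_eq_zero ha
  refine ⟨n, fun z hz => ?_⟩
  have h0 : a ^ n • (Submodule.Quotient.mk ⟨z, hz _⟩ :
      LinearMap.ker (P.sc' (i + 1) i ((ComplexShape.down ℕ).next i)).g.hom ⧸
        LinearMap.range (P.sc' (i + 1) i ((ComplexShape.down ℕ).next i)).moduleCatToCycles) =
        0 := by
    apply (chainHomologyEquiv P i).symm.injective
    rw [map_smul, hn, map_zero]
  rw [← Submodule.Quotient.mk_smul, Submodule.Quotient.mk_eq_zero] at h0
  obtain ⟨y, hy⟩ := h0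
  exact ⟨y, (congrArg Subtype.val hy).symm⟩

lemma exists_cycle_ne_d_of_nontrivial {i : ℕ} [hnt : Nontrivial (P.homology i)] :
    ∃ z : P.X i, (∀ j, P.d i j z = 0) ∧ ∀ y : P.X (i + 1), z ≠ P.d (i + 1) i y := by
  have := (chainHomologyEquiv P i).symm.toEquiv.nontrivial
  obtain ⟨q, hq⟩ := exists_ne (0 :
      LinearMap.ker (P.sc' (i + 1) i ((ComplexShape.down ℕ).next i)).g.hom ⧸
        LinearMap.range (P.sc' (i + 1) i ((ComplexShape.down ℕ).next i)).moduleCatToCycles)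
  obtain ⟨⟨z, hz⟩, rfl⟩ := Submodule.Quotient.mk_surjective _ q
  refine ⟨z, fun j => ?_, ?_⟩
  · by_cases hj : (ComplexShape.down ℕ).Rel i j
    · rw [← (ComplexShape.down ℕ).next_eq' hj]
      exact hz
    · rw [P.shape _ _ hj]
      rfl
  · rintro y rfl
    exact hq ((Submodule.Quotient.mk_eq_zero _).2 ⟨y, rfl⟩)

end ChainComplexHomology

section TotalDifferential

variable {R : Type*} [CommRing R] (P : ChainComplex (ModuleCat R) ℕ) (d : ℕ)

/-- The total differential on the direct sum of the terms of degree at most `d` of a complex. -/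
noncomputable def totalDifferential :
    (∀ j : Fin (d + 1), P.X j) →ₗ[R] (∀ j : Fin (d + 1), P.X j) :=
  LinearMap.pi fun i => ∑ j : Fin (d + 1), (P.d j i).hom ∘ₗ LinearMap.proj j

lemma totalDifferential_apply (x : ∀ j : Fin (d + 1), P.X j) (i : Fin (d + 1)) :
    totalDifferential P d x i = ∑ j : Fin (d + 1), P.d j i (x j) := by
  simp [totalDifferential]

lemma totalDifferential_apply_of_eq (x : ∀ j : Fin (d + 1), P.X j) {i j : Fin (d + 1)}
    (h : (j : ℕ) = i + 1) : totalDifferential P d x i = P.d j i (x j) := by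
  rw [totalDifferential_apply, Finset.sum_eq_single j]
  · intro l _ hl
    rw [P.shape _ _ (by
      intro h'
      exact hl (Fin.ext ((h'.symm : (l : ℕ) = i + 1).trans h.symm)))]
    rfl
  · exact fun h => absurd (Finset.mem_univ _) h

lemma totalDifferential_apply_last (x : ∀ j : Fin (d + 1), P.X j) {i : Fin (d + 1)}
    (h : (i : ℕ) = d) : totalDifferential P d x i = 0 := by
  rw [totalDifferential_apply]
  refine Finset.sum_eq_zero fun l _ => ?_
  rw [P.shape _ _ (by
    intro h'
    have h1 : (l : ℕ) = i + 1 := h'.symm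
    have := l.2
    omega)]
  rfl

lemma totalDifferential_totalDifferential (x : ∀ j : Fin (d + 1), P.X j) :
    totalDifferential P d (totalDifferential P d x) = 0 := by
  ext i
  rw [totalDifferential_apply, Pi.zero_apply]
  refine Finset.sum_eq_zero fun j _ => ?_
  rw [totalDifferential_apply, map_sum]
  refine Finset.sum_eq_zero fun l _ => ?_
  rw [← ModuleCat.comp_apply, P.d_comp_d]
  rfl

lemma totalDifferential_single [DecidableEq (Fin (d + 1))] (j : Fin (d + 1)) (v : P.X j)
    (i : Fin (d + 1)) : totalDifferential P d (Pi.single j v) i = P.d j i v := by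
  rw [totalDifferential_apply, Finset.sum_eq_single j]
  · rw [Pi.single_eq_same]
  · intro l _ hl
    rw [Pi.single_eq_of_ne hl, map_zero]
  · exact fun h => absurd (Finset.mem_univ _) h

lemma exists_pow_smul_eq_totalDifferential [IsLocalRing R] {d : ℕ}
    (hconc : ∀ j, d < j → Subsingleton (P.X j)) (hfl : ∀ i, IsFiniteLength R (P.homology i))
    {a : R} (ha : a ∈ IsLocalRing.maximalIdeal R) :
    ∃ n : ℕ, ∀ x, totalDifferential P d x = 0 → ∃ y, a ^ n • x = totalDifferential P d y := by
  choose n hn using fun i => exists_pow_smul_eq_d_of_isFiniteLength P (hfl i) ha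
  refine ⟨∑ i : Fin (d + 1), n i, fun x hx => ?_⟩
  have hcyc : ∀ (i : Fin (d + 1)) j, P.d i j (x i) = 0 := by
    intro i j
    by_cases hj : j + 1 = i
    · have := totalDifferential_apply_of_eq P d x (i := ⟨j, by omega⟩) (j := i) hj.symm
      rw [← this, hx]
      rfl
    · rw [P.shape _ _ hj]
      rfl
  have hy : ∀ i : ℕ, ∃ y : P.X (i + 1), ∀ h : i < d + 1,
      a ^ (∑ i : Fin (d + 1), n i) • x ⟨i, h⟩ = P.d (i + 1) i y := by
    intro i
    by_cases h : i < d + 1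
    · obtain ⟨y, hy⟩ := hn i (x ⟨i, h⟩) (hcyc ⟨i, h⟩)
      obtain ⟨m, hm⟩ := Nat.exists_eq_add_of_le
        (Finset.single_le_sum (f := fun i : Fin (d + 1) => n i) (fun _ _ => Nat.zero_le _)
          (Finset.mem_univ ⟨i, h⟩))
      refine ⟨a ^ m • y, fun _ => ?_⟩
      refine (congrArg (fun k => a ^ k • x ⟨i, h⟩) (hm.trans (add_comm _ _))).trans ?_
      change a ^ (m + n i) • x ⟨i, h⟩ = _
      rw [pow_add, mul_smul, hy, map_smul]
    · exact ⟨0, fun h' => absurd h' h⟩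
  choose y hy using hy
  let Y : ∀ j : ℕ, P.X j := fun j => match j with
    | 0 => 0
    | i + 1 => y i
  refine ⟨fun j => Y j, ?_⟩
  ext i
  rcases (Nat.lt_succ_iff.1 i.2).eq_or_lt with hi | hi
  · rw [totalDifferential_apply_last P d _ hi, Pi.smul_apply, hy i i.2]
    have := hconc (i + 1) (by omega)
    rw [Subsingleton.elim (y i) 0, map_zero]
  · rw [totalDifferential_apply_of_eq P d _ (j := ⟨i + 1, by omega⟩) rfl, Pi.smul_apply,
      hy i i.2]

lemma exists_ne_totalDifferential {d : ℕ}
    (hconc : ∀ j, d < j → Subsingleton (P.X j)) (hne : ∃ i, Nontrivial (P.homology i)) :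
    ∃ x, totalDifferential P d x = 0 ∧ ∀ y, x ≠ totalDifferential P d y := by
  obtain ⟨i, _⟩ := hne
  obtain ⟨z, hz, hz'⟩ := exists_cycle_ne_d_of_nontrivial P (i := i)
  have hi : i < d + 1 := by
    by_contra hi
    have := hconc i (by omega)
    exact hz' 0 (Subsingleton.elim _ _)
  refine ⟨Pi.single ⟨i, hi⟩ z, ?_, fun y hy => ?_⟩
  · ext l
    rw [totalDifferential_single]
    exact hz l
  · have h1 := congrFun hy ⟨i, hi⟩
    rw [Pi.single_eq_same] at h1
    rcases (Nat.lt_succ_iff.1 hi).eq_or_lt with h | h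
    · rw [totalDifferential_apply_last P d _ h] at h1
      exact hz' 0 (by rw [h1, map_zero])
    · rw [totalDifferential_apply_of_eq P d _ (j := ⟨i + 1, by omega⟩) rfl] at h1
      exact hz' _ h1

lemma exists_isTinyDifferential [IsLocalRing R] {d : ℕ} (hfree : ∀ j, Module.Free R (P.X j))
    (hfin : ∀ j, Module.Finite R (P.X j)) (hconc : ∀ j, d < j → Subsingleton (P.X j))
    (hfl : ∀ i, IsFiniteLength R (P.homology i)) (hne : ∃ i, Nontrivial (P.homology i)) :
    ∃ (A : Matrix (Σ j : Fin (d + 1), Fin (Module.finrank R (P.X j)))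
      (Σ j : Fin (d + 1), Fin (Module.finrank R (P.X j))) R),
      IsTinyDifferential A fun p => p.1 := by
  classical
  let b := Pi.basis fun j : Fin (d + 1) => Module.finBasis R (P.X j)
  have hmul : ∀ x, (LinearMap.toMatrix b b (totalDifferential P d)).mulVec (b.equivFun x) =
      b.equivFun (totalDifferential P d x) := fun x =>
    LinearMap.toMatrix_mulVec_repr b b (totalDifferential P d) x
  refine ⟨LinearMap.toMatrix b b (totalDifferential P d), ?_, ?_, ?_, ?_⟩
  · rw [← LinearMap.toMatrix_comp]
    have : totalDifferential P d ∘ₗ totalDifferential P d = 0 :=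
      LinearMap.ext (totalDifferential_totalDifferential P d)
    rw [this, map_zero]
  · rintro ⟨i, p⟩ ⟨j, q⟩ h
    by_contra hij
    refine h ?_
    rw [LinearMap.toMatrix_apply, Pi.basis_apply, Pi.basis_repr, totalDifferential_single,
      P.shape _ _ hij]
    simp
  · intro a ha
    obtain ⟨n, hn⟩ := exists_pow_smul_eq_totalDifferential P hconc hfl ha
    refine ⟨n, fun x hx => ?_⟩
    obtain ⟨x, rfl⟩ := b.equivFun.surjective x
    rw [hmul, LinearEquiv.map_eq_zero_iff] at hx
    obtain ⟨y, hy⟩ := hn x hx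
    exact ⟨b.equivFun y, by rw [hmul, ← hy, map_smul]⟩
  · obtain ⟨x, hx, hx'⟩ := exists_ne_totalDifferential P hconc hne
    refine ⟨b.equivFun x, by rw [hmul, hx, map_zero], fun y hy => ?_⟩
    obtain ⟨y, rfl⟩ := b.equivFun.surjective y
    rw [hmul] at hy
    exact hx' y (b.equivFun.injective hy)

end TotalDifferential

/-- Let `(R, m, k)` be a Noetherian local ring of Krull dimension `d`
whose residue field has characteristic `2`, and let `P` be a tiny complex over `R`: a
complex of finite rank free `R`-modules concentrated in degrees `0, …, d` with finite
length homology which is nonzero in some degree.  If `e = dim (R/2R)`, then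
`∑_j rank_R(P_j) ≥ 2^e ≥ 2^{d-1}`; and if `2` is nilpotent in `R`, then
`∑_j rank_R(P_j) ≥ 2^d`. -/
theorem stmt2 (R : Type) [CommRing R] [IsNoetherianRing R] [IsLocalRing R]
    [CharP (IsLocalRing.ResidueField R) 2]
    (d : ℕ) (hdim : ringKrullDim R = d)
    (e : ℕ) (he : ringKrullDim (R ⧸ Ideal.span {(2 : R)}) = e)
    (P : ChainComplex (ModuleCat R) ℕ)
    (hfree : ∀ j, Module.Free R (P.X j))
    (hfin : ∀ j, Module.Finite R (P.X j))
    (hconc : ∀ j, d < j → Subsingleton (P.X j))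
    (hfl : ∀ i, IsFiniteLength R (P.homology i))
    (hne : ∃ i, Nontrivial (P.homology i)) :
    2 ^ e ≤ ∑ j ∈ Finset.range (d + 1), Module.finrank R (P.X j) ∧
    2 ^ (d - 1) ≤ 2 ^ e ∧
    (IsNilpotent (2 : R) →
      2 ^ d ≤ ∑ j ∈ Finset.range (d + 1), Module.finrank R (P.X j)) := by
  have h2 : (2 : R) ∈ IsLocalRing.maximalIdeal R := by
    rw [← IsLocalRing.residue_eq_zero_iff, map_ofNat]
    exact CharP.ofNat_eq_zero _ 2
  have hsum : 2 ^ e ≤ ∑ j ∈ Finset.range (d + 1), Module.finrank R (P.X j) := by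
    obtain ⟨A, hA⟩ := exists_isTinyDifferential P hfree hfin hconc hfl hne
    refine (hA.two_pow_le_card h2 he.ge).trans_eq ?_
    rw [Fintype.card_sigma, Finset.sum_range]
    simp
  refine ⟨hsum, Nat.pow_le_pow_right two_pos ?_, fun hnil =>
    (Nat.pow_le_pow_right two_pos ?_).trans hsum⟩
  · have h := ringKrullDim_le_ringKrullDim_quotient_add_encard {(2 : R)}
      (by simpa [IsLocalRing.ringJacobson_eq_maximalIdeal] using h2)
    rw [hdim, he, Set.encard_singleton] at h
    have : d ≤ e + 1 := by exact_mod_cast h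
    omega
  · have h : ringKrullDim R ≤ ringKrullDim (R ⧸ Ideal.span {(2 : R)}) := by
      rw [ringKrullDim_quotient, ringKrullDim]
      refine Order.krullDim_le_of_strictMono
        (fun p => ⟨p, by simpa using p.2.mem_of_pow_mem _ (hnil.choose_spec ▸ p.1.zero_mem)⟩)
        fun _ _ h => h
    rw [hdim, he] at h
    exact_mod_cast h
end

section
/- Let R be a commutative ring and P a finitely generated projective R-module. Then the sequence 0 → Λ²_R(P) → P ⊗_R P → S²_R(P) → 0 is a short exact sequence of R-modules, where the first map sends x ∧ y to x ⊗ y − y ⊗ x and the second map is the canonical quotient. -/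
open scoped TensorProduct

/-- The relation submodule defining the second symmetric power: the span of all
`p ⊗ p' − p' ⊗ p`. -/
noncomputable def symRel (R P : Type*) [CommRing R] [AddCommGroup P] [Module R P] :
    Submodule R (TensorProduct R P P) :=
  Submodule.span R {z : TensorProduct R P P | ∃ p p' : P, z = p ⊗ₜ[R] p' - p' ⊗ₜ[R] p}

/-- The second symmetric power `S²_R(P)`. -/
noncomputable def Sym2Pow (R P : Type*) [CommRing R] [AddCommGroup P] [Module R P] : Type _ :=
  (TensorProduct R P P) ⧸ symRel R P

noncomputable instance (R P : Type*) [CommRing R] [AddCommGroup P] [Module R P] :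
    AddCommGroup (Sym2Pow R P) :=
  inferInstanceAs (AddCommGroup ((TensorProduct R P P) ⧸ symRel R P))

noncomputable instance (R P : Type*) [CommRing R] [AddCommGroup P] [Module R P] :
    Module R (Sym2Pow R P) :=
  inferInstanceAs (Module R ((TensorProduct R P P) ⧸ symRel R P))

/-- The second exterior power `Λ²_R(P)`, the quotient of `P ⊗[R] P` by the span of all
`p ⊗ p`. -/
noncomputable def Lam2Pow (R P : Type*) [CommRing R] [AddCommGroup P] [Module R P] : Type _ :=
  (TensorProduct R P P) ⧸
    (Submodule.span R {z : TensorProduct R P P | ∃ p : P, z = p ⊗ₜ[R] p})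

noncomputable instance (R P : Type*) [CommRing R] [AddCommGroup P] [Module R P] :
    AddCommGroup (Lam2Pow R P) :=
  inferInstanceAs (AddCommGroup ((TensorProduct R P P) ⧸
    (Submodule.span R {z : TensorProduct R P P | ∃ p : P, z = p ⊗ₜ[R] p})))

noncomputable instance (R P : Type*) [CommRing R] [AddCommGroup P] [Module R P] :
    Module R (Lam2Pow R P) :=
  inferInstanceAs (Module R ((TensorProduct R P P) ⧸
    (Submodule.span R {z : TensorProduct R P P | ∃ p : P, z = p ⊗ₜ[R] p})))

/-- The class of `x ⊗ y` in `Λ²_R(P)`, i.e. the wedge `x ∧ y`. -/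
noncomputable def Lam2Pow.mk {R P : Type*} [CommRing R] [AddCommGroup P] [Module R P]
    (x y : P) : Lam2Pow R P :=
  Submodule.Quotient.mk (x ⊗ₜ[R] y)

/-- The alternating bilinear map `(x, y) ↦ x ∧ y`. -/
noncomputable def Lam2Pow.mkBilin (R P : Type*) [CommRing R] [AddCommGroup P] [Module R P] :
    P →ₗ[R] P →ₗ[R] Lam2Pow R P :=
  TensorProduct.curry (Submodule.mkQ
    (Submodule.span R {z : TensorProduct R P P | ∃ p : P, z = p ⊗ₜ[R] p}))

theorem Lam2Pow.mkBilin_apply {R P : Type*} [CommRing R] [AddCommGroup P] [Module R P]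
    (x y : P) : Lam2Pow.mkBilin R P x y = Lam2Pow.mk x y := rfl

theorem Lam2Pow.mkBilin_self {R P : Type*} [CommRing R] [AddCommGroup P] [Module R P]
    (x : P) : Lam2Pow.mkBilin R P x x = 0 :=
  (Submodule.Quotient.mk_eq_zero _).2 (Submodule.subset_span ⟨x, rfl⟩)

theorem Lam2Pow.mkBilin_neg_swap {R P : Type*} [CommRing R] [AddCommGroup P] [Module R P]
    (x y : P) : -Lam2Pow.mkBilin R P y x = Lam2Pow.mkBilin R P x y := by
  have h := Lam2Pow.mkBilin_self (R := R) (x + y)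
  simp only [map_add, LinearMap.add_apply, Lam2Pow.mkBilin_self, zero_add, add_zero] at h
  rw [neg_eq_iff_add_eq_zero, ← h, add_comm]

/-- An alternating bilinear map on a free module is the antisymmetrization of a bilinear map. -/
theorem exists_sub_flip_eq_of_alternating {R ι M : Type*} [CommRing R] [AddCommGroup M]
    [Module R M] (A : (ι →₀ R) →ₗ[R] (ι →₀ R) →ₗ[R] M) (hself : ∀ x, A x x = 0)
    (hswap : ∀ x y, -A y x = A x y) :
    ∃ B : (ι →₀ R) →ₗ[R] (ι →₀ R) →ₗ[R] M, B - B.flip = A := by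
  classical
  let _ : LinearOrder ι := linearOrderOfSTO WellOrderingRel
  let e : ι → ι →₀ R := fun i => Finsupp.single i 1
  refine ⟨Finsupp.lift _ R ι fun i => Finsupp.lift M R ι fun k =>
    if i < k then A (e i) (e k) else 0, ?_⟩
  ext i k
  rcases lt_trichotomy i k with h | rfl | h
  · simp [h, h.not_gt, e]
  · simp [hself]
  · simp [h, h.not_gt, e, hswap]

/-- For a projective module, the wedge product is the antisymmetrization of a bilinear map. -/
theorem Lam2Pow.exists_sub_swap_eq_mk (R P : Type*) [CommRing R] [AddCommGroup P] [Module R P]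
    [Module.Projective R P] :
    ∃ r : TensorProduct R P P →ₗ[R] Lam2Pow R P,
      ∀ x y : P, r (x ⊗ₜ[R] y - y ⊗ₜ[R] x) = Lam2Pow.mk x y := by
  obtain ⟨i, hi⟩ := Module.projective_def.1 (inferInstance : Module.Projective R P)
  let s : (P →₀ R) →ₗ[R] P := Finsupp.linearCombination R id
  obtain ⟨B, hB⟩ := exists_sub_flip_eq_of_alternating
    ((Lam2Pow.mkBilin R P).compl₁₂ s s) (fun _ => Lam2Pow.mkBilin_self _)
    (fun _ _ => Lam2Pow.mkBilin_neg_swap _ _)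
  refine ⟨TensorProduct.lift (B.compl₁₂ i i), fun x y => ?_⟩
  have h := LinearMap.congr_fun₂ hB (i x) (i y)
  simp only [LinearMap.sub_apply, LinearMap.flip_apply, LinearMap.compl₁₂_apply] at h
  rw [hi x, hi y, Lam2Pow.mkBilin_apply] at h
  simpa using h

/-- The antisymmetrization map `x ∧ y ↦ x ⊗ y - y ⊗ x`. -/
noncomputable def Lam2Pow.toTensor (R P : Type*) [CommRing R] [AddCommGroup P] [Module R P] :
    Lam2Pow R P →ₗ[R] TensorProduct R P P :=
  Submodule.liftQ _ (LinearMap.id - (TensorProduct.comm R P P).toLinearMap) (by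
    rw [Submodule.span_le]
    rintro _ ⟨p, rfl⟩
    simp)

theorem Lam2Pow.toTensor_mk {R P : Type*} [CommRing R] [AddCommGroup P] [Module R P]
    (x y : P) : Lam2Pow.toTensor R P (Lam2Pow.mk x y) = x ⊗ₜ[R] y - y ⊗ₜ[R] x := rfl

theorem Lam2Pow.span_mk (R P : Type*) [CommRing R] [AddCommGroup P] [Module R P] :
    Submodule.span R {w : Lam2Pow R P | ∃ x y : P, w = Lam2Pow.mk x y} = ⊤ := by
  rw [eq_top_iff]
  rintro w -
  obtain ⟨t, rfl⟩ := Submodule.Quotient.mk_surjective _ w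
  induction t using TensorProduct.induction_on with
  | zero => exact Submodule.zero_mem _
  | tmul x y => exact Submodule.subset_span ⟨x, y, rfl⟩
  | add a b ha hb => exact Submodule.add_mem _ ha hb

theorem Lam2Pow.range_toTensor (R P : Type*) [CommRing R] [AddCommGroup P] [Module R P] :
    LinearMap.range (Lam2Pow.toTensor R P) = symRel R P := by
  rw [LinearMap.range_eq_map, ← Lam2Pow.span_mk, Submodule.map_span, symRel]
  congr 1
  ext z
  constructor
  · rintro ⟨_, ⟨x, y, rfl⟩, rfl⟩
    exact ⟨x, y, rfl⟩
  · rintro ⟨x, y, rfl⟩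
    exact ⟨_, ⟨x, y, rfl⟩, rfl⟩

theorem Lam2Pow.toTensor_injective (R P : Type*) [CommRing R] [AddCommGroup P] [Module R P]
    [Module.Projective R P] : Function.Injective (Lam2Pow.toTensor R P) := by
  obtain ⟨r, hr⟩ := Lam2Pow.exists_sub_swap_eq_mk R P
  have h : r ∘ₗ Lam2Pow.toTensor R P = LinearMap.id := by
    refine LinearMap.ext_on (Lam2Pow.span_mk R P) ?_
    rintro _ ⟨x, y, rfl⟩
    exact hr x y
  exact Function.LeftInverse.injective (LinearMap.congr_fun h)

/-- For a commutative ring `R` and a finitely generated projective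
`R`-module `P`, the sequence `0 → Λ²_R(P) → P ⊗_R P → S²_R(P) → 0` is short exact, where the
first map sends `x ∧ y` to `x ⊗ y − y ⊗ x` and the second map is the canonical quotient map. -/
theorem stmt8 (R P : Type) [CommRing R] [AddCommGroup P] [Module R P]
    [Module.Finite R P] [Module.Projective R P] :
    ∃ j : Lam2Pow R P →ₗ[R] TensorProduct R P P,
      (∀ x y : P, j (Lam2Pow.mk x y) = x ⊗ₜ[R] y - y ⊗ₜ[R] x) ∧
      Function.Injective j ∧
      Function.Surjective (symRel R P).mkQ ∧
      LinearMap.range j = LinearMap.ker (symRel R P).mkQ := by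
  exact ⟨Lam2Pow.toTensor R P, Lam2Pow.toTensor_mk, Lam2Pow.toTensor_injective R P,
    Submodule.mkQ_surjective _, by rw [Lam2Pow.range_toTensor, Submodule.ker_mkQ]⟩
end

section
/- Let k be a field of characteristic 2 and R = k[x_1, …, x_d]/(x_1², …, x_d²). If P = (0 → P_1 → P_0 → 0) is a complex of finite rank free R-modules concentrated in homological degrees 0 and 1 with nonzero homology, then h(P) := ∑_i dim_k H_i(P) ≥ 2^d. -/
/-- The ring `R = k[x_1, …, x_d]/(x_1², …, x_d²)`. -/
noncomputable abbrev SqZeroRing (k : Type) [Field k] (d : ℕ) : Type :=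
  MvPolynomial (Fin d) k ⧸
    Ideal.span (Set.range fun i : Fin d => (MvPolynomial.X i : MvPolynomial (Fin d) k) ^ 2)

section Congruence

variable {R m n : Type*} [CommRing R] [Fintype n]

/-- In characteristic two, `A S Aᵀ` has zero diagonal when `S` is symmetric and the entries of `A`
square to zero. -/
theorem Matrix.IsSymm.mul_mul_transpose_apply_self_eq_zero [CharP R 2] {A : Matrix m n R}
    {S : Matrix n n R} (hS : S.IsSymm) (hA : ∀ i j, A i j ^ 2 = 0) (i : m) :
    (A * S * A.transpose) i i = 0 := by
  have h : (A * S * A.transpose) i i = ∑ p : n × n, A i p.1 * S p.1 p.2 * A i p.2 := by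
    simp only [Matrix.mul_apply, Matrix.transpose_apply, Finset.sum_mul]
    rw [Finset.sum_comm, Fintype.sum_prod_type]
  rw [h]
  refine Finset.sum_involution (fun p _ => p.swap) ?_ ?_ (fun _ _ => Finset.mem_univ _)
    (fun p _ => Prod.swap_swap p)
  · rintro ⟨j, l⟩ -
    have : A i l * S l j * A i j = A i j * S j l * A i l := by rw [hS.apply]; ring
    simp only [Prod.swap, this]
    exact CharTwo.add_self_eq_zero _
  · rintro ⟨j, l⟩ - hne heq
    obtain rfl : l = j := congrArg Prod.fst heq
    exact hne (by linear_combination S l l * hA i l)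

variable {k : Type*} [Field k] [Algebra k R] [Module.Finite k R] [Fintype m]

/-- The space of matrices `S` with `A S B = 0`, where `B = Aᵀ`, injects modulo those with `A S = 0`
into matrices whose rows lie in the kernel of `A`. -/
theorem Matrix.finrank_le_of_mul_mul_transpose_eq_zero (A : Matrix m n R)
    (E : Submodule k (Matrix n n R)) (hE : ∀ S ∈ E, A * S * A.transpose = 0) :
    Module.finrank k E ≤ (Fintype.card m + Fintype.card n) *
      Module.finrank k (LinearMap.ker A.mulVecLin) := by
  have : IsNoetherianRing R := isNoetherian_of_tower k inferInstance
  have : Module.Finite k (LinearMap.ker A.mulVecLin) := Module.Finite.trans R _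
  let rows : E →ₗ[k] (m → LinearMap.ker A.mulVecLin) :=
    { toFun := fun S i => ⟨(A * S.1) i, by
        ext l
        have := congrFun (congrFun (hE S.1 S.2) i) l
        simpa [Matrix.mul_apply, Matrix.mulVec, dotProduct, mul_comm] using this⟩
      map_add' := fun S T => by
        ext i l
        simp [Matrix.mul_add]
      map_smul' := fun c S => by
        ext i l
        simp }
  let cols : LinearMap.ker rows →ₗ[k] (n → LinearMap.ker A.mulVecLin) :=
    { toFun := fun S l => ⟨fun j => S.1.1 j l, by
        ext i
        have := congrArg Subtype.val (congrFun (LinearMap.mem_ker.1 S.2) i)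
        exact congrFun this l⟩
      map_add' := fun S T => rfl
      map_smul' := fun c S => rfl }
  have hcols : Function.Injective cols := fun S T h => by
    ext j l
    exact congrFun (congrArg Subtype.val (congrFun h l)) j
  have h₁ := LinearMap.finrank_range_add_finrank_ker rows
  have h₂ := (LinearMap.range rows).finrank_le
  have h₃ := LinearMap.finrank_le_finrank_of_injective hcols
  rw [Module.finrank_pi_fintype, Finset.sum_const, Finset.card_univ, smul_eq_mul] at h₂ h₃
  rw [add_mul]
  omega

/-- Counting dimensions along the map `S ↦ A S Aᵀ` from symmetric to alternating matrices. -/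
theorem Matrix.finrank_mul_choose_le [CharP R 2] (A : Matrix m n R)
    (hA : ∀ i j, A i j ^ 2 = 0) :
    Module.finrank k R * (Fintype.card n + 1).choose 2 ≤
      Module.finrank k R * (Fintype.card m).choose 2 +
        (Fintype.card m + Fintype.card n) * Module.finrank k (LinearMap.ker A.mulVecLin) := by
  classical
  let sym : (Sym2 n → R) →ₗ[k] Matrix n n R :=
    { toFun := fun g => Matrix.of fun i j => g s(i, j)
      map_add' := fun _ _ => rfl
      map_smul' := fun _ _ => rfl }
  have sym_symm (g : Sym2 n → R) : (sym g).IsSymm := by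
    ext i j
    exact congrArg g Sym2.eq_swap
  have sym_inj : Function.Injective sym := fun g g' h => by
    ext p
    induction p with
    | _ i j => exact congrFun (congrFun h i) j
  have conj_symm (g : Sym2 n → R) : (A * sym g * A.transpose).IsSymm := by
    rw [Matrix.IsSymm, Matrix.transpose_mul, Matrix.transpose_mul, Matrix.transpose_transpose,
      sym_symm, Matrix.mul_assoc]
  let alt : (Sym2 n → R) →ₗ[k] ({p : Sym2 m // ¬ p.IsDiag} → R) :=
    { toFun := fun g p => Sym2.lift ⟨fun i j => (A * sym g * A.transpose) i j,
        fun i j => (conj_symm g).apply j i⟩ p.1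
      map_add' := fun g g' => by
        ext ⟨p, hp⟩
        induction p with
        | _ i j => simp [Matrix.mul_add, Matrix.add_mul]
      map_smul' := fun c g => by
        ext ⟨p, hp⟩
        induction p with
        | _ i j => simp }
  have hker : ∀ S ∈ (LinearMap.ker alt).map sym, A * S * A.transpose = 0 := by
    rintro _ ⟨g, hg, rfl⟩
    ext i j
    by_cases hij : i = j
    · subst hij
      exact (sym_symm g).mul_mul_transpose_apply_self_eq_zero hA i
    · exact congrFun (LinearMap.mem_ker.1 hg) ⟨s(i, j), by simpa using hij⟩
  have h₁ := LinearMap.finrank_range_add_finrank_ker alt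
  have h₂ := (LinearMap.range alt).finrank_le
  have h₃ := Matrix.finrank_le_of_mul_mul_transpose_eq_zero A _ hker
  rw [((LinearMap.ker alt).equivMapOfInjective sym sym_inj).finrank_eq.symm] at h₃
  simp only [Module.finrank_pi_fintype, Finset.sum_const, Finset.card_univ, smul_eq_mul,
    Sym2.card_subtype_not_diag, Sym2.card, mul_comm _ (Module.finrank k R)] at h₁ h₂
  omega

end Congruence

section Complex

variable {k R : Type*} [Field k] [CommRing R] [Algebra k R]

theorem Module.Free.ker_of_apply_eq_one [IsLocalRing R] {M : Type*} [AddCommGroup M] [Module R M]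
    [Module.Free R M] [Module.Finite R M] (φ : M →ₗ[R] R) {e : M} (he : φ e = 1) :
    Module.Free R (LinearMap.ker φ) := by
  let s : M →ₗ[R] LinearMap.ker φ :=
    (LinearMap.id - φ.smulRight e).codRestrict _ (fun x => by simp [he])
  have hs : s ∘ₗ (LinearMap.ker φ).subtype = LinearMap.id := LinearMap.ext fun x =>
    Subtype.ext (show x.1 - φ x.1 • e = x.1 by simp)
  have : Module.Projective R (LinearMap.ker φ) := Module.Projective.of_split _ s hs
  have : Module.Finite R (LinearMap.ker φ) :=
    Module.Finite.of_surjective s (LinearMap.surjective_of_comp_eq_id _ _ hs)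
  exact Module.free_of_flat_of_isLocalRing

theorem finrank_ker_add_of_apply_eq_one {M : Type*} [AddCommGroup M] [Module R M]
    [Module k M] [IsScalarTower k R M] [Module.Finite k M] (φ : M →ₗ[R] R) {e : M}
    (he : φ e = 1) :
    Module.finrank k R + Module.finrank k (LinearMap.ker φ) = Module.finrank k M := by
  have h := LinearMap.finrank_range_add_finrank_ker (φ.restrictScalars k)
  have hsurj : Function.Surjective (φ.restrictScalars k) := fun r => ⟨r • e, by simp [he]⟩
  rw [LinearMap.range_eq_top.2 hsurj, finrank_top] at h
  exact h

variable [Module.Finite k R]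

/-- The bound for a minimal two-term complex. -/
theorem finrank_add_finrank_le_of_sq_eq_zero [Nontrivial R] [CharP R 2]
    {P₀ P₁ ι₀ ι₁ : Type*} [AddCommGroup P₀] [Module R P₀] [Module k P₀] [IsScalarTower k R P₀]
    [AddCommGroup P₁] [Module R P₁] [Module k P₁] [IsScalarTower k R P₁]
    [Fintype ι₀] [Fintype ι₁] [DecidableEq ι₁] (b₀ : Module.Basis ι₀ R P₀)
    (b₁ : Module.Basis ι₁ R P₁)
    (f : P₁ →ₗ[R] P₀) (hf : ∀ i j, LinearMap.toMatrix b₁ b₀ f i j ^ 2 = 0)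
    (hne : ¬ (Module.finrank k (LinearMap.ker f) = 0 ∧
      Module.finrank k P₁ = Module.finrank k P₀)) :
    Module.finrank k R + Module.finrank k P₁ ≤
      2 * Module.finrank k (LinearMap.ker f) + Module.finrank k P₀ := by
  set A := LinearMap.toMatrix b₁ b₀ f
  have hcount := Matrix.finrank_mul_choose_le (k := k) A hf
  have hker : LinearMap.ker A.mulVecLin = (LinearMap.ker f).map b₁.equivFun.toLinearMap := by
    ext v
    obtain ⟨x, rfl⟩ := b₁.equivFun.surjective v
    have hx : A.mulVecLin (b₁.equivFun x) = b₀.equivFun (f x) :=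
      LinearMap.toMatrix_mulVec_repr b₁ b₀ f x
    rw [LinearMap.mem_ker, hx]
    simp
  have hfin : Module.finrank k (LinearMap.ker A.mulVecLin) =
      Module.finrank k (LinearMap.ker f) := by
    rw [hker]
    exact ((b₁.equivFun.submoduleMap (LinearMap.ker f)).restrictScalars k).finrank_eq.symm
  have h₀ : Module.finrank k P₀ = Fintype.card ι₀ * Module.finrank k R := by
    rw [(b₀.equivFun.restrictScalars k).finrank_eq]
    simp [Module.finrank_pi_fintype]
  have h₁ : Module.finrank k P₁ = Fintype.card ι₁ * Module.finrank k R := by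
    rw [(b₁.equivFun.restrictScalars k).finrank_eq]
    simp [Module.finrank_pi_fintype]
  have : Module.Finite R P₁ := Module.Finite.of_basis b₁
  have : Module.Finite k P₁ := Module.Finite.trans R P₁
  have hle : Module.finrank k (LinearMap.ker f) ≤ Module.finrank k P₁ :=
    ((LinearMap.ker f).restrictScalars k).finrank_le
  rw [hfin] at hcount
  rw [h₀, h₁] at hne
  rw [h₁] at hle
  rw [h₀, h₁]
  clear h₀ h₁ hfin
  generalize Module.finrank k (LinearMap.ker f) = c at *
  generalize Module.finrank k R = q at *
  generalize Fintype.card ι₀ = a at *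
  generalize Fintype.card ι₁ = b at *
  have hpos : 0 < a + b := by
    rcases Nat.eq_zero_or_pos (a + b) with h | h
    · obtain ⟨rfl, rfl⟩ : a = 0 ∧ b = 0 := by omega
      exact absurd ⟨by simpa using hle, rfl⟩ hne
    · exact h
  have ha : (a.choose 2 : ℤ) * 2 = a * (a - 1) := by
    have : (a.choose 2 : ℚ) * 2 = a * (a - 1) := by rw [Nat.cast_choose_two]; ring
    exact_mod_cast this
  have hb : ((b + 1).choose 2 : ℤ) * 2 = (b + 1) * b := by
    have : ((b + 1).choose 2 : ℚ) * 2 = (b + 1) * b := by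
      rw [Nat.cast_choose_two]; push_cast; ring
    exact_mod_cast this
  zify at hcount hpos ⊢
  have : ((a : ℤ) + b) * (q + b * q) ≤ (a + b) * (2 * c + a * q) := by
    linear_combination 2 * hcount + q * ha - q * hb
  exact le_of_mul_le_mul_left this hpos

/-- A two-term complex of finite free modules over a local ring of characteristic two in which
every nonunit squares to zero: unless the map is bijective, the total homology is at least as
large as the ring. -/
theorem finrank_add_finrank_le [IsLocalRing R] [CharP R 2] (hR : ∀ r : R, IsUnit r ∨ r ^ 2 = 0)
    (N : ℕ) {P₀ P₁ : Type*} [AddCommGroup P₀] [Module R P₀] [Module k P₀] [IsScalarTower k R P₀]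
    [AddCommGroup P₁] [Module R P₁] [Module k P₁] [IsScalarTower k R P₁]
    [Module.Free R P₀] [Module.Finite R P₀] [Module.Free R P₁] [Module.Finite R P₁]
    (f : P₁ →ₗ[R] P₀) (hN : Module.finrank k P₀ ≤ N)
    (hne : ¬ (Module.finrank k (LinearMap.ker f) = 0 ∧
      Module.finrank k P₁ = Module.finrank k P₀)) :
    Module.finrank k R + Module.finrank k P₁ ≤
      2 * Module.finrank k (LinearMap.ker f) + Module.finrank k P₀ := by
  classical
  have : IsNoetherianRing R := isNoetherian_of_tower k inferInstance
  have hq : 0 < Module.finrank k R := Module.finrank_pos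
  induction N using Nat.strong_induction_on generalizing P₀ P₁ with
  | _ N ih =>
  have : Module.Finite k P₀ := Module.Finite.trans R P₀
  have : Module.Finite k P₁ := Module.Finite.trans R P₁
  let b₀ := Module.Free.chooseBasis R P₀
  let b₁ := Module.Free.chooseBasis R P₁
  by_cases hA : ∀ i j, LinearMap.toMatrix b₁ b₀ f i j ^ 2 = 0
  · exact finrank_add_finrank_le_of_sq_eq_zero b₀ b₁ f hA hne
  push Not at hA
  obtain ⟨i, j, hij⟩ := hA
  obtain ⟨u, hu⟩ := (hR _).resolve_right hij
  rw [LinearMap.toMatrix_apply] at hu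
  let lam : P₀ →ₗ[R] R := (↑u⁻¹ : R) • b₀.coord i
  have hlam : lam (f (b₁ j)) = 1 := by
    simp [lam, ← hu]
  have hlam' : (lam ∘ₗ f) (b₁ j) = 1 := hlam
  have := Module.Free.ker_of_apply_eq_one lam hlam
  have := Module.Free.ker_of_apply_eq_one (lam ∘ₗ f) hlam'
  have h₀ := finrank_ker_add_of_apply_eq_one (k := k) lam hlam
  have h₁ := finrank_ker_add_of_apply_eq_one (k := k) (lam ∘ₗ f) hlam'
  let g : LinearMap.ker (lam ∘ₗ f) →ₗ[R] LinearMap.ker lam :=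
    (f ∘ₗ (LinearMap.ker (lam ∘ₗ f)).subtype).codRestrict _ fun x => x.2
  have hg : Module.finrank k (LinearMap.ker g) = Module.finrank k (LinearMap.ker f) := by
    rw [show LinearMap.ker g = _ from LinearMap.ker_codRestrict _ _ _, LinearMap.ker_comp]
    exact ((Submodule.comapSubtypeEquivOfLe
      (LinearMap.ker_le_ker_comp f lam)).restrictScalars k).finrank_eq
  have := ih (Module.finrank k (LinearMap.ker lam)) (by omega) g le_rfl
    (by rw [hg]; omega)
  omega

end Complex
section SqZeroRing

variable {k : Type} [Field k] {d : ℕ}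

theorem SqZeroRing.exists_sq_eq_algebraMap [CharP k 2] (r : SqZeroRing k d) :
    ∃ c : k, r ^ 2 = algebraMap k (SqZeroRing k d) c := by
  have : CharP (MvPolynomial (Fin d) k) 2 := inferInstance
  obtain ⟨p, rfl⟩ := Ideal.Quotient.mk_surjective r
  rw [← map_pow]
  induction p using MvPolynomial.induction_on with
  | C a => exact ⟨a ^ 2, by rw [← map_pow]; rfl⟩
  | add p q hp hq =>
    obtain ⟨a, ha⟩ := hp
    obtain ⟨b, hb⟩ := hq
    exact ⟨a + b, by rw [CharTwo.add_sq, map_add, ha, hb, map_add]⟩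
  | mul_X p i _ =>
    refine ⟨0, ?_⟩
    rw [map_zero, Ideal.Quotient.eq_zero_iff_mem, mul_pow]
    exact Ideal.mul_mem_left _ _ (Ideal.subset_span ⟨i, rfl⟩)

theorem SqZeroRing.isUnit_or_sq_eq_zero [CharP k 2] (r : SqZeroRing k d) :
    IsUnit r ∨ r ^ 2 = 0 := by
  obtain ⟨c, hc⟩ := SqZeroRing.exists_sq_eq_algebraMap r
  by_cases h : c = 0
  · exact .inr (by rw [hc, h, map_zero])
  · refine .inl ((isUnit_pow_iff two_ne_zero).1 ?_)
    rw [hc]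
    exact (IsUnit.mk0 c h).map _

instance SqZeroRing.finite [CharP k 2] : Module.Finite k (SqZeroRing k d) := by
  have : Algebra.IsIntegral k (SqZeroRing k d) := ⟨fun r => by
    obtain ⟨c, hc⟩ := SqZeroRing.exists_sq_eq_algebraMap r
    exact IsIntegral.of_pow two_pos (hc ▸ isIntegral_algebraMap)⟩
  exact Algebra.IsIntegral.finite

/-- The squarefree monomials are linearly independent. -/
theorem SqZeroRing.two_pow_le_finrank [CharP k 2] :
    2 ^ d ≤ Module.finrank k (SqZeroRing k d) := by
  classical
  let I : Ideal (MvPolynomial (Fin d) k) := Ideal.span (Set.range fun i => MvPolynomial.X i ^ 2)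
  let expo : Finset (Fin d) → Fin d →₀ ℕ := fun s => Finsupp.indicator s fun _ _ => 1
  let coeffs : MvPolynomial (Fin d) k →ₗ[k] (Finset (Fin d) → k) :=
    LinearMap.pi fun s => MvPolynomial.lcoeff k (expo s)
  have hI : I.restrictScalars k ≤ LinearMap.ker coeffs := by
    intro p hp
    have hspan : I = Ideal.span ((fun e => MvPolynomial.monomial e (1 : k)) ''
        Set.range fun i : Fin d => Finsupp.single i 2) := by
      rw [← Set.range_comp]
      simp only [I, MvPolynomial.X_pow_eq_monomial, Function.comp_def]
    rw [Submodule.restrictScalars_mem, hspan, MvPolynomial.mem_ideal_span_monomial_image] at hp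
    ext s
    by_contra hs
    obtain ⟨_, ⟨i, rfl⟩, hi⟩ := hp (expo s) (MvPolynomial.mem_support_iff.2 hs)
    have := hi i
    simp only [Finsupp.single_eq_same, expo, Finsupp.indicator_apply] at this
    split_ifs at this <;> omega
  let φ : SqZeroRing k d →ₗ[k] (Finset (Fin d) → k) := (I.restrictScalars k).liftQ coeffs hI
  have hinj : Function.Injective expo := fun s t h => by
    ext i
    have := DFunLike.congr_fun h i
    simp only [expo, Finsupp.indicator_apply] at this
    split_ifs at this <;> simp_all
  have hφ : Function.Surjective φ := fun v => by
    refine ⟨Ideal.Quotient.mk I (∑ s, MvPolynomial.monomial (expo s) (v s)), ?_⟩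
    change coeffs _ = v
    ext t
    simp [coeffs, MvPolynomial.coeff_monomial, hinj.eq_iff]
  simpa using LinearMap.finrank_le_finrank_of_surjective hφ

instance SqZeroRing.nontrivial [CharP k 2] : Nontrivial (SqZeroRing k d) :=
  Module.nontrivial_of_finrank_pos (R := k)
    (lt_of_lt_of_le (by positivity) SqZeroRing.two_pow_le_finrank)

instance SqZeroRing.isLocalRing [CharP k 2] : IsLocalRing (SqZeroRing k d) := by
  have : CharP (SqZeroRing k d) 2 := charP_of_injective_algebraMap' k 2
  refine IsLocalRing.of_nonunits_add fun {a b} ha hb => ?_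
  have h : (a + b) ^ 2 = 0 := by
    rw [CharTwo.add_sq, (SqZeroRing.isUnit_or_sq_eq_zero a).resolve_left ha,
      (SqZeroRing.isUnit_or_sq_eq_zero b).resolve_left hb, add_zero]
  exact fun hu => not_isUnit_zero (h ▸ hu.pow 2)

end SqZeroRing

/-- Let `k` be a field of characteristic `2` and
`R = k[x_1, …, x_d]/(x_1², …, x_d²)`.  If `P = (0 → P₁ →f P₀ → 0)` is a complex of finite
rank free `R`-modules concentrated in degrees `0` and `1` with nonzero homology (i.e. `f`
is not bijective, so that `H₁ = ker f` and `H₀ = coker f` are not both zero), then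
`h(P) = dim_k H₁(P) + dim_k H₀(P) ≥ 2^d`. -/
theorem stmt17 (k : Type) [Field k] [CharP k 2] (d : ℕ)
    (P₀ P₁ : Type) [AddCommGroup P₀] [Module (SqZeroRing k d) P₀]
    [AddCommGroup P₁] [Module (SqZeroRing k d) P₁]
    [Module.Free (SqZeroRing k d) P₀] [Module.Finite (SqZeroRing k d) P₀]
    [Module.Free (SqZeroRing k d) P₁] [Module.Finite (SqZeroRing k d) P₁]
    (f : P₁ →ₗ[SqZeroRing k d] P₀)
    (hne : ¬ Function.Bijective f) :
    2 ^ d ≤ Module.finrank k (RestrictScalars k (SqZeroRing k d) (LinearMap.ker f)) +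
      Module.finrank k (RestrictScalars k (SqZeroRing k d) (P₀ ⧸ LinearMap.range f)) := by
  let : Module k P₀ := Module.restrictScalars k (SqZeroRing k d) P₀
  let : Module k P₁ := Module.restrictScalars k (SqZeroRing k d) P₁
  have : IsScalarTower k (SqZeroRing k d) P₀ := IsScalarTower.restrictScalars k (SqZeroRing k d) P₀
  have : IsScalarTower k (SqZeroRing k d) P₁ := IsScalarTower.restrictScalars k (SqZeroRing k d) P₁
  have : Module.Finite k P₀ := Module.Finite.trans (SqZeroRing k d) P₀
  have : Module.Finite k P₁ := Module.Finite.trans (SqZeroRing k d) P₁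
  have : CharP (SqZeroRing k d) 2 := charP_of_injective_algebraMap' k 2
  change 2 ^ d ≤ Module.finrank k (LinearMap.ker (f.restrictScalars k)) +
    Module.finrank k (P₀ ⧸ LinearMap.range (f.restrictScalars k))
  have hrange := LinearMap.finrank_range_add_finrank_ker (f.restrictScalars k)
  have hcoker := (LinearMap.range (f.restrictScalars k)).finrank_quotient_add_finrank
  have hbound := finrank_add_finrank_le (k := k) SqZeroRing.isUnit_or_sq_eq_zero _ f le_rfl
    fun ⟨hker, heq⟩ => hne <| by
      have hinj : Function.Injective (f.restrictScalars k) :=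
        LinearMap.ker_eq_bot.1 (Submodule.finrank_eq_zero.1 hker)
      exact ⟨hinj, (LinearMap.injective_iff_surjective_of_finrank_eq_finrank heq).1 hinj⟩
  have hdim : 2 ^ d ≤ Module.finrank k (SqZeroRing k d) := SqZeroRing.two_pow_le_finrank
  change _ ≤ 2 * Module.finrank k (LinearMap.ker (f.restrictScalars k)) + _ at hbound
  omega
end

section
/- Let k be a field of characteristic 2 and R = k[x_1, …, x_d]/(x_1², …, x_d²). If P = (0 → P_2 → P_1 → P_0 → 0) is a complex of finite rank free R-modules concentrated in homological degrees 0, 1, 2 with nonzero homology, then h(P) := ∑_i dim_k H_i(P) ≥ 2^{d−1}. -/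
namespace SqZeroRing
variable (k : Type) [Field k] (d : ℕ)

theorem mk_X_sq (i : Fin d) :
    (Ideal.Quotient.mk _ (MvPolynomial.X i) : SqZeroRing k d) ^ 2 = 0 := by
  rw [← map_pow]
  exact Ideal.Quotient.eq_zero_iff_mem.2 (Ideal.subset_span ⟨i, rfl⟩)

theorem coeff_eq_zero_of_mem {p : MvPolynomial (Fin d) k}
    (hp : p ∈ Ideal.span (Set.range fun i : Fin d =>
      (MvPolynomial.X i : MvPolynomial (Fin d) k) ^ 2))
    {m : Fin d →₀ ℕ} (hm : ∀ i, m i ≤ 1) : p.coeff m = 0 := by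
  have hset : (Set.range fun i : Fin d => (MvPolynomial.X i : MvPolynomial (Fin d) k) ^ 2) =
      (fun s => MvPolynomial.monomial s (1 : k)) ''
        Set.range fun i : Fin d => Finsupp.single i 2 := by
    rw [← Set.range_comp]
    congr 1
    ext1 i
    exact MvPolynomial.X_pow_eq_monomial
  rw [hset, MvPolynomial.mem_ideal_span_monomial_image] at hp
  by_contra hne
  obtain ⟨_, ⟨i, rfl⟩, hi⟩ := hp m (MvPolynomial.mem_support_iff.2 hne)
  have := hi i
  have := hm i
  simp only [Finsupp.single_eq_same] at *
  omega

instance : Nontrivial (SqZeroRing k d) := by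
  refine Ideal.Quotient.nontrivial_iff.2 fun h => ?_
  have := coeff_eq_zero_of_mem k d (p := 1) (h ▸ Submodule.mem_top) (m := 0) (by simp)
  simp at this

instance [CharP k 2] : CharP (SqZeroRing k d) 2 :=
  charP_of_injective_algebraMap (algebraMap k (SqZeroRing k d)).injective 2

theorem exists_sq_eq_algebraMap_s18 [CharP k 2] (y : SqZeroRing k d) :
    ∃ c : k, y ^ 2 = algebraMap k (SqZeroRing k d) c := by
  obtain ⟨p, rfl⟩ := Ideal.Quotient.mk_surjective y
  induction p using MvPolynomial.induction_on with
  | C a => exact ⟨a ^ 2, by rw [map_pow]; rfl⟩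
  | add p q hp hq =>
    obtain ⟨a, ha⟩ := hp
    obtain ⟨b, hb⟩ := hq
    exact ⟨a + b, by rw [map_add, CharTwo.add_sq, ha, hb, map_add]⟩
  | mul_X p i _ => exact ⟨0, by rw [map_mul, mul_pow, mk_X_sq, mul_zero, map_zero]⟩

theorem sq_eq_zero_of_not_isUnit [CharP k 2] {y : SqZeroRing k d} (hy : ¬ IsUnit y) :
    y ^ 2 = 0 := by
  obtain ⟨c, hc⟩ := exists_sq_eq_algebraMap_s18 k d y
  rcases eq_or_ne c 0 with rfl | h
  · rw [hc, map_zero]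
  · refine absurd ((isUnit_pow_iff two_ne_zero).1 ?_) hy
    rw [hc]
    exact h.isUnit.map _

instance [CharP k 2] : IsLocalRing (SqZeroRing k d) :=
  .of_nonunits_add fun a b ha hb hab => by
    have := hab.pow 2
    rw [CharTwo.add_sq, sq_eq_zero_of_not_isUnit k d ha, sq_eq_zero_of_not_isUnit k d hb,
      add_zero] at this
    exact not_isUnit_zero this

instance [CharP k 2] : Module.Finite k (SqZeroRing k d) := by
  have : Algebra.IsIntegral k (SqZeroRing k d) := ⟨fun y => by
    obtain ⟨c, hc⟩ := exists_sq_eq_algebraMap_s18 k d y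
    refine IsIntegral.of_pow two_pos ?_
    rw [hc]
    exact isIntegral_algebraMap⟩
  exact Algebra.IsIntegral.finite

theorem two_pow_le_finrank_s18 [CharP k 2] : 2 ^ d ≤ Module.finrank k (SqZeroRing k d) := by
  let e (s : Finset (Fin d)) : Fin d →₀ ℕ := Finsupp.indicator s fun _ _ => 1
  have he (s : Finset (Fin d)) (i : Fin d) : e s i = if i ∈ s then 1 else 0 := by
    simp [e, Finsupp.indicator_apply]
  have hinj : Function.Injective e := fun s t h => by
    ext i
    have := DFunLike.congr_fun h i
    rw [he, he] at this
    by_cases hs : i ∈ s <;> by_cases ht : i ∈ t <;> simp_all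
  have hli : LinearIndependent k fun s : Finset (Fin d) =>
      (Ideal.Quotient.mk _ (MvPolynomial.monomial (e s) (1 : k)) : SqZeroRing k d) := by
    rw [Fintype.linearIndependent_iff]
    intro g hg t
    have hmk : (Ideal.Quotient.mk _ (∑ s, MvPolynomial.monomial (e s) (g s)) : SqZeroRing k d)
        = 0 := by
      rw [← hg, map_sum]
      refine Finset.sum_congr rfl fun s _ => ?_
      rw [← mul_one (g s), ← smul_eq_mul, ← MvPolynomial.smul_monomial, smul_eq_mul, mul_one]
      rfl
    have := coeff_eq_zero_of_mem k d (Ideal.Quotient.eq_zero_iff_mem.1 hmk) (m := e t)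
      (fun i => by rw [he]; split_ifs <;> simp)
    simpa [MvPolynomial.coeff_sum, MvPolynomial.coeff_monomial, hinj.eq_iff] using this
  simpa using hli.fintype_card_le_finrank

end SqZeroRing

namespace Matrix

theorem mul_mul_transpose_apply_self_eq_zero {R m n : Type*} [CommRing R] [CharP R 2]
    [Fintype n] [DecidableEq n] (F : Matrix m n R) (hF : ∀ i j, F i j ^ 2 = 0)
    {S : Matrix n n R} (hS : Sᵀ = S) (i : m) : (F * S * Fᵀ) i i = 0 := by
  have hS' (a b : n) : S a b = S b a := congrFun (congrFun hS b) a
  simp only [Matrix.mul_apply, Matrix.transpose_apply, Finset.sum_mul]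
  rw [← Fintype.sum_prod_type (f := fun p : n × n => F i p.2 * S p.2 p.1 * F i p.1)]
  refine Finset.sum_involution (fun p _ => p.swap) ?_ ?_ (by simp) (by simp)
  · rintro ⟨a, b⟩ -
    have : F i a * S a b * F i b = F i b * S b a * F i a := by rw [hS' a b]; ring
    simp only [Prod.swap]
    rw [this, CharTwo.add_self_eq_zero]
  · rintro ⟨a, b⟩ - hne hab
    obtain rfl : b = a := congrArg Prod.fst hab
    refine hne ?_
    linear_combination S b b * hF i b

theorem eq_zero_of_transpose_eq_self {R n : Type*} [Zero R] [LinearOrder n]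
    {Y : Matrix n n R} (hY : Yᵀ = Y) (hdiag : ∀ i, Y i i = 0) (hlow : ∀ i j, j < i → Y i j = 0) :
    Y = 0 := by
  ext i j
  rcases lt_trichotomy i j with h | rfl | h
  · exact (congrFun (congrFun hY i) j).symm.trans (hlow j i h)
  · exact hdiag i
  · exact hlow i j h

theorem exists_add_transpose {R n : Type*} [CommRing R] [CharP R 2] [LinearOrder n]
    {M : Matrix n n R} (hM : Mᵀ = M) (hdiag : ∀ i, M i i = 0) :
    ∃ T : Matrix n n R, M = T + Tᵀ := by
  refine ⟨.of fun i j => if i < j then M i j else 0, ?_⟩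
  ext i j
  have := congrFun (congrFun hM i) j
  rw [Matrix.transpose_apply] at this
  rcases lt_trichotomy i j with h | rfl | h <;> simp_all [not_lt_of_gt]

theorem add_self_of_charTwo {R m n : Type*} [CommRing R] [CharP R 2] (X : Matrix m n R) :
    X + X = 0 := by
  ext; exact CharTwo.add_self_eq_zero _

theorem eq_of_add_eq_zero_of_charTwo {R m n : Type*} [CommRing R] [CharP R 2]
    {X Y : Matrix m n R} (h : X + Y = 0) : X = Y := by
  rw [eq_neg_of_add_eq_zero_left h, ← eq_neg_of_add_eq_zero_left Y.add_self_of_charTwo]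

theorem mul_mul_eq_zero_of_mul_eq_zero {R l m n p : Type*} [CommRing R] [Fintype m] [Fintype n]
    {F : Matrix l m R} {G : Matrix m n R} (h : F * G = 0) (X : Matrix n p R) :
    F * (G * X) = 0 := by
  rw [← Matrix.mul_assoc, h, Matrix.zero_mul]

theorem blocks_eq_zero {R I J K : Type*} [CommRing R] [CharP R 2] [Fintype I] [Fintype J]
    [Fintype K] [LinearOrder I] [LinearOrder J] [LinearOrder K]
    (F : Matrix I J R) (G : Matrix J K R) (hFG : F * G = 0)
    (hF : ∀ i j, F i j ^ 2 = 0) (hG : ∀ i j, G i j ^ 2 = 0)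
    {M10 : Matrix J I R} {M11 : Matrix J J R} {M12 : Matrix J K R}
    {M20 : Matrix K I R} {M21 : Matrix K J R} {M22 : Matrix K K R}
    (h22 : ∀ i j, j < i → (M22 + M22ᵀ) i j = 0)
    (h21 : M21 + M12ᵀ + M22 * Gᵀ = 0)
    (h11 : ∀ i j, j < i → (G * M21 + M12 * Gᵀ + M11 + M11ᵀ) i j = 0)
    (h20 : M20 + M21 * Fᵀ = 0)
    (h10 : G * M20 + M11 * Fᵀ + M10 = 0)
    (h00 : ∀ i j, j < i → (F * M10) i j = 0)
    (hdiag : (∀ i, (F * M10) i i = 0) ∨ ∀ i, M22 i i = 0) :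
    F * M10 = 0 ∧ F * M11 + M10ᵀ = 0 ∧ F * M12 + M20ᵀ = 0 ∧
      G * M21 + M12 * Gᵀ + M11 + M11ᵀ = 0 ∧ G * M22 + M12 + M21ᵀ = 0 := by
  have hsym : M22 = M22ᵀ := by
    refine eq_of_add_eq_zero_of_charTwo (Matrix.eq_zero_of_transpose_eq_self ?_ ?_ h22)
    · rw [Matrix.transpose_add, Matrix.transpose_transpose, add_comm]
    · intro i; exact CharTwo.add_self_eq_zero _
  have e21 : M21 = M12ᵀ + M22 * Gᵀ :=
    eq_of_add_eq_zero_of_charTwo (by rw [← add_assoc]; exact h21)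
  have e12 : M21ᵀ = M12 + G * M22 := by
    rw [e21, Matrix.transpose_add, Matrix.transpose_mul, ← hsym]; simp
  have h12 : G * M22 + M12 + M21ᵀ = 0 := by rw [e12, add_comm M12]; exact add_self_of_charTwo _
  have hM12 : M12 = M21ᵀ + G * M22 := by rw [e12, add_assoc, add_self_of_charTwo, add_zero]
  set S := G * M22 * Gᵀ with hS
  have hSsym : Sᵀ = S := by
    simp only [hS, Matrix.transpose_mul, Matrix.transpose_transpose, ← hsym, Matrix.mul_assoc]
  have hM12G : M12 * Gᵀ = (G * M21)ᵀ + S := by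
    rw [hM12, Matrix.add_mul, Matrix.transpose_mul]
  have hFS : F * S = 0 := by
    rw [hS, Matrix.mul_assoc, ← Matrix.mul_assoc, hFG, Matrix.zero_mul]
  have hGF (X : Matrix J K R) : X * (Gᵀ * Fᵀ) = 0 := by
    rw [← Matrix.transpose_mul, hFG, Matrix.transpose_zero, Matrix.mul_zero]
  have e11 : G * M21 + M12 * Gᵀ + M11 + M11ᵀ = 0 := by
    refine Matrix.eq_zero_of_transpose_eq_self ?_ ?_ h11
    · simp only [hM12G, Matrix.transpose_add, Matrix.transpose_transpose, hSsym]
      abel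
    · intro i
      have : S i i = 0 := Matrix.mul_mul_transpose_apply_self_eq_zero G hG hsym.symm i
      simp only [hM12G, Matrix.add_apply, Matrix.transpose_apply, this, add_zero,
        CharTwo.add_self_eq_zero, zero_add]
  have hsum : M11 + M11ᵀ = G * M21 + (G * M21)ᵀ + S := by
    refine (eq_of_add_eq_zero_of_charTwo ?_).symm
    rw [← e11, hM12G]; abel
  have e20 : M20 = M21 * Fᵀ := eq_of_add_eq_zero_of_charTwo h20
  have e10 : M10 = G * M20 + M11 * Fᵀ := (eq_of_add_eq_zero_of_charTwo h10).symm
  have h02 : F * M12 + M20ᵀ = 0 := by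
    rw [e20, Matrix.transpose_mul, Matrix.transpose_transpose, ← Matrix.mul_add, e12, ← add_assoc,
      add_self_of_charTwo, zero_add, mul_mul_eq_zero_of_mul_eq_zero hFG]
  have e00 : F * M10 = F * M11 * Fᵀ := by
    rw [e10, Matrix.mul_add, mul_mul_eq_zero_of_mul_eq_zero hFG, zero_add, Matrix.mul_assoc]
  have h01 : F * M11 + M10ᵀ = 0 := by
    rw [e10, Matrix.transpose_add, Matrix.transpose_mul M11, Matrix.transpose_transpose,
      add_left_comm, ← Matrix.mul_add, hsum, e20, ← Matrix.mul_assoc, Matrix.transpose_mul,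
      Matrix.transpose_transpose, Matrix.mul_add, Matrix.mul_add,
      mul_mul_eq_zero_of_mul_eq_zero hFG, hFS, zero_add, add_zero,
      add_self_of_charTwo]
  have h00sym : (F * M11 * Fᵀ)ᵀ = F * M11 * Fᵀ := by
    refine eq_of_add_eq_zero_of_charTwo ?_
    rw [Matrix.transpose_mul, Matrix.transpose_mul, Matrix.transpose_transpose, ← Matrix.mul_assoc,
      ← Matrix.add_mul, ← Matrix.mul_add, add_comm, hsum, Matrix.mul_add, Matrix.mul_add,
      mul_mul_eq_zero_of_mul_eq_zero hFG, hFS, zero_add, add_zero, Matrix.transpose_mul,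
      Matrix.mul_assoc, Matrix.mul_assoc, hGF, Matrix.mul_zero]
  refine ⟨?_, h01, h02, e11, h12⟩
  refine Matrix.eq_zero_of_transpose_eq_self (by rw [e00, h00sym]) ?_ h00
  refine hdiag.elim id fun hd => ?_
  obtain ⟨T, hT⟩ := Matrix.exists_add_transpose hsym.symm hd
  set X := G * M21 + G * T * Gᵀ with hX
  have hFX : F * X = 0 := by
    rw [hX, Matrix.mul_add, mul_mul_eq_zero_of_mul_eq_zero hFG, Matrix.mul_assoc,
      mul_mul_eq_zero_of_mul_eq_zero hFG, add_zero]
  have hXsum : M11 + M11ᵀ = X + Xᵀ := by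
    have : S = G * T * Gᵀ + (G * T * Gᵀ)ᵀ := by
      rw [hS, hT, Matrix.mul_add, Matrix.add_mul]
      simp only [Matrix.transpose_mul, Matrix.transpose_transpose, Matrix.mul_assoc]
    rw [hsum, this, hX, Matrix.transpose_add]
    abel
  have hsymX : (M11 + X)ᵀ = M11 + X := by
    refine eq_of_add_eq_zero_of_charTwo ?_
    rw [Matrix.transpose_add]
    calc M11ᵀ + Xᵀ + (M11 + X) = (M11 + M11ᵀ) + (X + Xᵀ) := by abel
      _ = 0 := by rw [hXsum, add_self_of_charTwo]
  intro i
  have := Matrix.mul_mul_transpose_apply_self_eq_zero F hF hsymX i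
  rwa [Matrix.mul_add, hFX, add_zero, ← e00] at this

/-- The strictly lower triangular part of a square matrix. -/
def lower {k R : Type*} [Semiring k] [AddCommMonoid R] [Module k R] (n : ℕ) :
    Matrix (Fin n) (Fin n) R →ₗ[k] (i : Fin n) → Fin i → R where
  toFun M i j := M i (j.castLE i.2.le)
  map_add' _ _ := rfl
  map_smul' _ _ := rfl

theorem lower_eq_zero_iff {k R : Type*} [Semiring k] [AddCommMonoid R] [Module k R] {n : ℕ}
    {M : Matrix (Fin n) (Fin n) R} : lower (k := k) n M = 0 ↔ ∀ i j, j < i → M i j = 0 := by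
  refine ⟨fun h i j hij => congrFun (congrFun h i) ⟨j, hij⟩, fun h => ?_⟩
  ext i j
  exact h _ _ j.2

theorem two_mul_finrank_lower (k R : Type*) [Field k] [AddCommGroup R] [Module k R]
    [Module.Finite k R] (n : ℕ) :
    2 * Module.finrank k ((i : Fin n) → Fin i → R) + n * Module.finrank k R =
      n ^ 2 * Module.finrank k R := by
  simp only [Module.finrank_pi_fintype, Finset.sum_const, Finset.card_univ, Fintype.card_fin,
    smul_eq_mul]
  rw [← Finset.sum_mul, Fin.sum_univ_eq_sum_range (fun i => i) n, ← mul_assoc, mul_comm 2,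
    Finset.sum_range_id_mul_two, ← add_mul]
  congr 1
  cases n <;> simp; ring

/-- The matrix whose columns are the images under `ι` of a family of vectors. -/
def ofCols {k R C I : Type*} [Semiring k] [AddCommMonoid R] [Module k R]
    [AddCommMonoid C] [Module k C] (ι : C →ₗ[k] I → R) (J : Type*) :
    (J → C) →ₗ[k] Matrix I J R where
  toFun c := .of fun i j => ι (c j) i
  map_add' _ _ := by ext; simp
  map_smul' _ _ := by ext; simp

theorem eq_zero_of_mul_ofCols_eq_zero {k R C I J H : Type*} [Semiring k] [CommRing R] [Module k R]
    [AddCommMonoid C] [Module k C] [Fintype I] {ι : C →ₗ[k] I → R} {F : Matrix H I R}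
    (hι : ∀ c, F *ᵥ ι c = 0 → c = 0) {c : J → C} (h : F * ofCols ι J c = 0) : c = 0 := by
  ext j
  refine hι _ ?_
  ext i
  exact congrFun (congrFun h i) j

theorem finrank_blocks_le {k R : Type*} [Field k] [CommRing R] [CharP R 2] [Algebra k R]
    [Module.Finite k R] {p q r : ℕ}
    {F : Matrix (Fin p) (Fin q) R} {G : Matrix (Fin q) (Fin r) R} (hFG : F * G = 0)
    (hF : ∀ i j, F i j ^ 2 = 0) (hG : ∀ i j, G i j ^ 2 = 0)
    {C D : Type*} [AddCommGroup C] [Module k C] [Module.Finite k C]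
    [AddCommGroup D] [Module k D] [Module.Finite k D]
    {ι : C →ₗ[k] Fin q → R} (hι : ∀ c, F *ᵥ ι c = 0 → c = 0)
    {κ : D →ₗ[k] Fin r → R} (hκ : ∀ c, G *ᵥ κ c = 0 → c = 0)
    {m : ℕ} (δ : Matrix (Fin q) (Fin p) R →ₗ[k] Fin m → R)
    (ε : Matrix (Fin r) (Fin r) R →ₗ[k] Fin m → R)
    (hδε : ∀ M N, δ M + ε N = 0 → (∀ i, (F * M) i i = 0) ∨ ∀ i, N i i = 0) :
    2 * ((p + q + r) * (Module.finrank k C + Module.finrank k D)) +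
      (p + q + r) * Module.finrank k R ≤
        ((p + q + r) ^ 2 + 2 * m) * Module.finrank k R := by
  let Φ : (((Fin p → C) × (Fin q → C) × (Fin r → C)) × (Fin p → D) × (Fin q → D) × (Fin r → D))
      →ₗ[k] ((i : Fin p) → Fin i → R) × ((i : Fin q) → Fin i → R) × ((i : Fin r) → Fin i → R) ×
        Matrix (Fin q) (Fin p) R × Matrix (Fin r) (Fin p) R × Matrix (Fin r) (Fin q) R ×
        (Fin m → R) :=
    { toFun := fun x =>
        let M10 := ofCols ι (Fin p) x.1.1
        let M11 := ofCols ι (Fin q) x.1.2.1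
        let M12 := ofCols ι (Fin r) x.1.2.2
        let M20 := ofCols κ (Fin p) x.2.1
        let M21 := ofCols κ (Fin q) x.2.2.1
        let M22 := ofCols κ (Fin r) x.2.2.2
        (lower (k := k) p (F * M10), lower (k := k) q (G * M21 + M12 * Gᵀ + M11 + M11ᵀ),
          lower (k := k) r (M22 + M22ᵀ), G * M20 + M11 * Fᵀ + M10, M20 + M21 * Fᵀ,
          M21 + M12ᵀ + M22 * Gᵀ, δ M10 + ε M22)
      map_add' := fun x y => by
        simp only [Prod.fst_add, Prod.snd_add, map_add, Matrix.mul_add, Matrix.add_mul,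
          Matrix.transpose_add, Prod.mk_add_mk, Prod.mk.injEq, true_and]
        refine ⟨?_, ?_, ?_, ?_, ?_, ?_⟩ <;> abel
      map_smul' := fun a x => by
        simp only [Prod.smul_fst, Prod.smul_snd, map_smul, Matrix.mul_smul, Matrix.smul_mul,
          Matrix.transpose_smul, smul_add, map_add, RingHom.id_apply, Prod.smul_mk] }
  have hΦ : Function.Injective Φ := by
    rw [← LinearMap.ker_eq_bot, LinearMap.ker_eq_bot']
    rintro ⟨⟨c0, c1, c2⟩, d0, d1, d2⟩ h
    simp only [Φ, LinearMap.coe_mk, AddHom.coe_mk, Prod.mk_eq_zero, lower_eq_zero_iff] at h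
    obtain ⟨h00, h11, h22, h10, h20, h21, hd⟩ := h
    obtain ⟨e00, e01, e02, e11, e12⟩ :=
      blocks_eq_zero F G hFG hF hG h22 h21 h11 h20 h10 h00 (hδε _ _ hd)
    obtain rfl := eq_zero_of_mul_ofCols_eq_zero hι e00
    simp only [map_zero, Matrix.transpose_zero, add_zero] at e01 h10
    obtain rfl := eq_zero_of_mul_ofCols_eq_zero hι e01
    simp only [map_zero, Matrix.zero_mul, add_zero] at h10 e11
    obtain rfl := eq_zero_of_mul_ofCols_eq_zero hκ h10
    simp only [map_zero, Matrix.transpose_zero, add_zero] at e02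
    obtain rfl := eq_zero_of_mul_ofCols_eq_zero hι e02
    simp only [map_zero, Matrix.zero_mul, Matrix.transpose_zero, add_zero] at e11
    obtain rfl := eq_zero_of_mul_ofCols_eq_zero hκ e11
    simp only [map_zero, Matrix.transpose_zero, add_zero] at e12
    obtain rfl := eq_zero_of_mul_ofCols_eq_zero hκ e12
    rfl
  have hle := LinearMap.finrank_le_finrank_of_injective hΦ
  have hp := two_mul_finrank_lower k R p
  have hq := two_mul_finrank_lower k R q
  have hr := two_mul_finrank_lower k R r
  have hC (n : ℕ) : Module.finrank k (Fin n → C) = n * Module.finrank k C := by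
    simp [Module.finrank_pi_fintype]
  have hD (n : ℕ) : Module.finrank k (Fin n → D) = n * Module.finrank k D := by
    simp [Module.finrank_pi_fintype]
  have hR : Module.finrank k (Fin m → R) = m * Module.finrank k R := by
    simp [Module.finrank_pi_fintype]
  have hM (s t : ℕ) : Module.finrank k (Matrix (Fin s) (Fin t) R) = s * t * Module.finrank k R := by
    rw [Module.finrank_matrix]; simp
  simp only [Module.finrank_prod, hC, hD, hR, hM] at hle
  nlinarith

end Matrix

section FreeComplexes

variable {k R : Type*} [Field k] [CommRing R] [Algebra k R]

theorem LinearMap.finrank_range_add_finrank_ker_of_tower {A B : Type*} [AddCommGroup A]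
    [Module R A] [Module k A] [IsScalarTower k R A] [AddCommGroup B] [Module R B] [Module k B]
    [IsScalarTower k R B] [Module.Finite k A] (f : A →ₗ[R] B) :
    Module.finrank k (LinearMap.range f) + Module.finrank k (LinearMap.ker f) =
      Module.finrank k A :=
  (f.restrictScalars k).finrank_range_add_finrank_ker

theorem LinearMap.finrank_ker_restrict {A B : Type*} [AddCommGroup A] [Module R A] [Module k A]
    [IsScalarTower k R A] [AddCommGroup B] [Module R B] (f : A →ₗ[R] B)
    {S : Submodule R A} {T : Submodule R B} (h : ∀ x ∈ S, f x ∈ T) (hS : LinearMap.ker f ≤ S) :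
    Module.finrank k (LinearMap.ker (f.restrict h)) = Module.finrank k (LinearMap.ker f) := by
  have hmap : (LinearMap.ker (f.restrict h)).map S.subtype = LinearMap.ker f := by
    rw [LinearMap.ker_restrict, Submodule.map_comap_subtype,
      inf_eq_right.2 hS]
  rw [← hmap]
  exact (((LinearMap.ker (f.restrict h)).equivMapOfInjective S.subtype
    S.injective_subtype).restrictScalars k).finrank_eq

theorem LinearMap.free_ker_of_apply_eq_one [IsLocalRing R] [IsNoetherianRing R]
    {P : Type*} [AddCommGroup P] [Module R P] [Module.Finite R P] [Module.Free R P]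
    {v : P} {l : P →ₗ[R] R} (hv : l v = 1) : Module.Free R (LinearMap.ker l) := by
  have : Module.Projective R (LinearMap.ker l) := by
    refine Module.Projective.of_split (LinearMap.ker l).subtype
      ((LinearMap.id - l.smulRight v).codRestrict (LinearMap.ker l) fun x => ?_) ?_
    · ext x
      simp
    · simp [hv]
  exact Module.free_of_flat_of_isLocalRing

theorem LinearMap.finrank_ker_add_one [Module.Finite k R] [Nontrivial R]
    {P : Type*} [AddCommGroup P] [Module R P] [Module k P] [IsScalarTower k R P]
    [Module.Free R P] [Module.Finite R P] {v : P} {l : P →ₗ[R] R} (hv : l v = 1)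
    [Module.Free R (LinearMap.ker l)] :
    Module.finrank R (LinearMap.ker l) + 1 = Module.finrank R P := by
  have : Module.Finite k P := Module.Finite.trans R P
  have h := l.finrank_range_add_finrank_ker_of_tower (k := k)
  have hr : LinearMap.range l = ⊤ :=
    LinearMap.range_eq_top.2 fun r => ⟨r • v, by rw [map_smul, hv, smul_eq_mul, mul_one]⟩
  have ht : Module.finrank k (⊤ : Submodule R R) = Module.finrank k R :=
    ((Submodule.topEquiv (R := R) (M := R)).restrictScalars k).finrank_eq
  rw [hr, ht, ← Module.finrank_mul_finrank k R P,
    ← Module.finrank_mul_finrank k R (LinearMap.ker l)] at h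
  have hpos : 0 < Module.finrank k R := Module.finrank_pos
  refine Nat.eq_of_mul_eq_mul_left hpos ?_
  rw [← h]; ring

theorem finrank_add_le_of_nonunits [CharP R 2] [Nontrivial R] [Module.Finite k R]
    (hR : ∀ y : R, ¬ IsUnit y → y ^ 2 = 0)
    {P₀ P₁ P₂ : Type*} [AddCommGroup P₀] [Module R P₀] [Module k P₀] [IsScalarTower k R P₀]
    [AddCommGroup P₁] [Module R P₁] [Module k P₁] [IsScalarTower k R P₁]
    [AddCommGroup P₂] [Module R P₂] [Module k P₂] [IsScalarTower k R P₂]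
    [Module.Free R P₀] [Module.Finite R P₀] [Module.Free R P₁] [Module.Finite R P₁]
    [Module.Free R P₂] [Module.Finite R P₂] (f₁ : P₁ →ₗ[R] P₀) (f₂ : P₂ →ₗ[R] P₁)
    (hcomp : f₁ ∘ₗ f₂ = 0)
    (h₁ : ∀ (l : P₀ →ₗ[R] R) x, ¬ IsUnit (l (f₁ x)))
    (h₂ : ∀ (l : P₁ →ₗ[R] R) x, ¬ IsUnit (l (f₂ x))) :
    2 * ((Module.finrank R P₀ + Module.finrank R P₁ + Module.finrank R P₂) *
        (Module.finrank k (LinearMap.range f₁) + Module.finrank k (LinearMap.range f₂))) +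
      (Module.finrank R P₀ + Module.finrank R P₁ + Module.finrank R P₂) * Module.finrank k R ≤
        ((Module.finrank R P₀ + Module.finrank R P₁ + Module.finrank R P₂) ^ 2 +
          2 * min (Module.finrank R P₀) (Module.finrank R P₂)) * Module.finrank k R := by
  have : Module.Finite k P₁ := Module.Finite.trans R P₁
  have : Module.Finite k P₂ := Module.Finite.trans R P₂
  have : Module.Finite k P₀ := Module.Finite.trans R P₀
  let b₀ := Module.finBasis R P₀
  let b₁ := Module.finBasis R P₁
  let b₂ := Module.finBasis R P₂
  let F := LinearMap.toMatrix b₁ b₀ f₁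
  let G := LinearMap.toMatrix b₂ b₁ f₂
  have hFG : F * G = 0 := by
    rw [← LinearMap.toMatrix_comp, hcomp, map_zero]
  have hF (i j) : F i j ^ 2 = 0 := by
    simp only [F, LinearMap.toMatrix_apply]
    exact hR _ (h₁ (b₀.coord i) _)
  have hG (i j) : G i j ^ 2 = 0 := by
    simp only [G, LinearMap.toMatrix_apply]
    exact hR _ (h₂ (b₁.coord i) _)
  obtain ⟨s₁, hs₁⟩ := (f₁.restrictScalars k).rangeRestrict.exists_rightInverse_of_surjective
    (LinearMap.range_rangeRestrict _)
  obtain ⟨s₂, hs₂⟩ := (f₂.restrictScalars k).rangeRestrict.exists_rightInverse_of_surjective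
    (LinearMap.range_rangeRestrict _)
  have hι (c) (hc : F.mulVec (((b₁.equivFun.restrictScalars k).toLinearMap ∘ₗ s₁) c) = 0) :
      c = 0 := by
    have h : b₀.repr (f₁ (s₁ c)) = 0 := by
      ext i
      exact (congrFun (LinearMap.toMatrix_mulVec_repr b₁ b₀ f₁ (s₁ c)) i).symm.trans
        (congrFun hc i)
    rw [LinearEquiv.map_eq_zero_iff] at h
    exact (LinearMap.congr_fun hs₁ c).symm.trans (Subtype.ext h)
  have hκ (c) (hc : G.mulVec (((b₂.equivFun.restrictScalars k).toLinearMap ∘ₗ s₂) c) = 0) :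
      c = 0 := by
    have h : b₁.repr (f₂ (s₂ c)) = 0 := by
      ext i
      exact (congrFun (LinearMap.toMatrix_mulVec_repr b₂ b₁ f₂ (s₂ c)) i).symm.trans
        (congrFun hc i)
    rw [LinearEquiv.map_eq_zero_iff] at h
    exact (LinearMap.congr_fun hs₂ c).symm.trans (Subtype.ext h)
  rcases le_total (Module.finrank R P₀) (Module.finrank R P₂) with hle | hle
  · rw [min_eq_left hle]
    refine Matrix.finrank_blocks_le hFG hF hG hι hκ
      { toFun := fun M => (F * M).diag
        map_add' := fun M N => by rw [Matrix.mul_add, Matrix.diag_add]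
        map_smul' := fun a M => by rw [Matrix.mul_smul, Matrix.diag_smul]; rfl } 0
      fun M N h => Or.inl fun i => ?_
    simpa using congrFun h i
  · rw [min_eq_right hle]
    refine Matrix.finrank_blocks_le hFG hF hG hι hκ 0 (Matrix.diagLinearMap _ k R)
      fun M N h => Or.inr fun i => ?_
    simpa using congrFun h i

theorem finrank_add_four_mul_finrank_range_le [CharP R 2] [IsLocalRing R] [Module.Finite k R]
    (hR : ∀ y : R, ¬ IsUnit y → y ^ 2 = 0) (n : ℕ)
    (P₀ P₁ P₂ : Type*) [AddCommGroup P₀] [Module R P₀] [Module k P₀] [IsScalarTower k R P₀]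
    [AddCommGroup P₁] [Module R P₁] [Module k P₁] [IsScalarTower k R P₁]
    [AddCommGroup P₂] [Module R P₂] [Module k P₂] [IsScalarTower k R P₂]
    [Module.Free R P₀] [Module.Finite R P₀] [Module.Free R P₁] [Module.Finite R P₁]
    [Module.Free R P₂] [Module.Finite R P₂] (f₁ : P₁ →ₗ[R] P₀) (f₂ : P₂ →ₗ[R] P₁)
    (hcomp : f₁ ∘ₗ f₂ = 0)
    (hn : Module.finrank R P₀ + Module.finrank R P₁ + Module.finrank R P₂ = n)
    (hlt : 2 * (Module.finrank k (LinearMap.range f₁) + Module.finrank k (LinearMap.range f₂)) <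
      Module.finrank k R * n) :
    Module.finrank k R +
      4 * (Module.finrank k (LinearMap.range f₁) + Module.finrank k (LinearMap.range f₂)) ≤
        2 * (Module.finrank k R * n) := by
  induction n using Nat.strong_induction_on generalizing P₀ P₁ P₂ with
  | _ n ih =>
  have : IsNoetherianRing R := isNoetherian_of_tower k inferInstance
  have : Module.Finite k P₁ := Module.Finite.trans R P₁
  have : Module.Finite k P₂ := Module.Finite.trans R P₂
  have : Module.Finite k P₀ := Module.Finite.trans R P₀
  have hr₁ := f₁.finrank_range_add_finrank_ker_of_tower (k := k)
  have hr₂ := f₂.finrank_range_add_finrank_ker_of_tower (k := k)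
  rw [← Module.finrank_mul_finrank k R P₁] at hr₁
  rw [← Module.finrank_mul_finrank k R P₂] at hr₂
  have hcomp' (x : P₂) : f₁ (f₂ x) = 0 := LinearMap.congr_fun hcomp x
  by_cases h₁ : ∃ (l : P₀ →ₗ[R] R) (x : P₁), IsUnit (l (f₁ x))
  · obtain ⟨l', x, u, hu⟩ := h₁
    obtain ⟨l, hl⟩ : ∃ l : P₀ →ₗ[R] R, l (f₁ x) = 1 :=
      ⟨(↑u⁻¹ : R) • l', by rw [LinearMap.smul_apply, ← hu, smul_eq_mul, Units.inv_mul]⟩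
    have hl' : (l ∘ₗ f₁) x = 1 := hl
    have := LinearMap.free_ker_of_apply_eq_one hl
    have := LinearMap.free_ker_of_apply_eq_one hl'
    have : Module.Finite k (LinearMap.ker (l ∘ₗ f₁)) := Module.Finite.trans R _
    have d₀ := LinearMap.finrank_ker_add_one (k := k) hl
    have d₁ := LinearMap.finrank_ker_add_one (k := k) hl'
    let g₁ : LinearMap.ker (l ∘ₗ f₁) →ₗ[R] LinearMap.ker l := f₁.restrict fun _ hx => hx
    let g₂ : P₂ →ₗ[R] LinearMap.ker (l ∘ₗ f₁) :=
      f₂.codRestrict _ fun y => by simp [hcomp']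
    have hg₁ := g₁.finrank_range_add_finrank_ker_of_tower (k := k)
    have hg₂ := g₂.finrank_range_add_finrank_ker_of_tower (k := k)
    have hk₁ : Module.finrank k (LinearMap.ker g₁) = Module.finrank k (LinearMap.ker f₁) :=
      LinearMap.finrank_ker_restrict f₁ _ (LinearMap.ker_le_ker_comp f₁ l)
    rw [hk₁,
      ← Module.finrank_mul_finrank k R (LinearMap.ker (l ∘ₗ f₁))] at hg₁
    rw [LinearMap.ker_codRestrict, ← Module.finrank_mul_finrank k R P₂] at hg₂
    obtain ⟨m, rfl⟩ : ∃ m, n = m + 2 := ⟨n - 2, by omega⟩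
    rw [← d₁, mul_add_one] at hr₁
    rw [mul_add (Module.finrank k R) m 2] at hlt ⊢
    have := ih m (by omega) (LinearMap.ker l) (LinearMap.ker (l ∘ₗ f₁)) P₂ g₁ g₂
      (LinearMap.ext fun y => Subtype.ext (hcomp' y)) (by omega) (by omega)
    omega
  by_cases h₂ : ∃ (l : P₁ →ₗ[R] R) (x : P₂), IsUnit (l (f₂ x))
  · obtain ⟨l', x, u, hu⟩ := h₂
    obtain ⟨l, hl⟩ : ∃ l : P₁ →ₗ[R] R, l (f₂ x) = 1 :=
      ⟨(↑u⁻¹ : R) • l', by rw [LinearMap.smul_apply, ← hu, smul_eq_mul, Units.inv_mul]⟩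
    have hl' : (l ∘ₗ f₂) x = 1 := hl
    have := LinearMap.free_ker_of_apply_eq_one hl
    have := LinearMap.free_ker_of_apply_eq_one hl'
    have d₁ := LinearMap.finrank_ker_add_one (k := k) hl
    have : Module.Finite k (LinearMap.ker (l ∘ₗ f₂)) := Module.Finite.trans R _
    have d₂ := LinearMap.finrank_ker_add_one (k := k) hl'
    let g₁ : LinearMap.ker l →ₗ[R] P₀ := f₁.domRestrict _
    let g₂ : LinearMap.ker (l ∘ₗ f₂) →ₗ[R] LinearMap.ker l := f₂.restrict fun _ hx => hx
    have hg₁ : LinearMap.range g₁ = LinearMap.range f₁ := by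
      refine le_antisymm (LinearMap.range_domRestrict_le_range f₁ _) ?_
      rintro _ ⟨y, rfl⟩
      exact ⟨⟨y - l y • f₂ x, by simp [hl]⟩, by simp [g₁, hcomp']⟩
    have hg₂ := g₂.finrank_range_add_finrank_ker_of_tower (k := k)
    have hk₂ : Module.finrank k (LinearMap.ker g₂) = Module.finrank k (LinearMap.ker f₂) :=
      LinearMap.finrank_ker_restrict f₂ _ (LinearMap.ker_le_ker_comp f₂ l)
    rw [hk₂,
      ← Module.finrank_mul_finrank k R (LinearMap.ker (l ∘ₗ f₂))] at hg₂
    obtain ⟨m, rfl⟩ : ∃ m, n = m + 2 := ⟨n - 2, by omega⟩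
    rw [← d₂, mul_add_one] at hr₂
    rw [mul_add (Module.finrank k R) m 2] at hlt ⊢
    have := ih m (by omega) P₀ (LinearMap.ker l) (LinearMap.ker (l ∘ₗ f₂)) g₁ g₂
      (LinearMap.ext fun y => hcomp' y) (by omega) (by rw [hg₁]; omega)
    rw [hg₁] at this
    omega
  push Not at h₁ h₂
  have hmain := finrank_add_le_of_nonunits (k := k) hR f₁ f₂ hcomp h₁ h₂
  rw [hn] at hmain
  have hNpos : 0 < Module.finrank k R := Module.finrank_pos
  set N := Module.finrank k R
  rcases lt_or_ge (Module.finrank R P₁) (Module.finrank R P₀ + Module.finrank R P₂) with hχ | hχ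
  · have hle : LinearMap.range f₂ ≤ LinearMap.ker f₁ := LinearMap.range_le_ker_iff.2 hcomp
    have hle' : Module.finrank k (LinearMap.range f₂) ≤ Module.finrank k (LinearMap.ker f₁) :=
      Submodule.finrank_mono (s := (LinearMap.range f₂).restrictScalars k)
        (t := (LinearMap.ker f₁).restrictScalars k) hle
    have : N * (2 * Module.finrank R P₁ + 1) ≤ N * n := Nat.mul_le_mul_left _ (by omega)
    simp only [mul_add, mul_left_comm N 2] at this
    omega
  · have hmin : 4 * min (Module.finrank R P₀) (Module.finrank R P₂) ≤ n := by omega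
    have hnpos : 0 < n := Nat.pos_of_ne_zero (by rintro rfl; simp at hlt)
    refine le_of_mul_le_mul_left ?_ hnpos
    nlinarith

end FreeComplexes

theorem RestrictScalars.finrank_eq (k R M : Type*) [Field k] [CommRing R] [Algebra k R]
    [AddCommGroup M] [Module R M] [Module k M] [IsScalarTower k R M] :
    Module.finrank k (RestrictScalars k R M) = Module.finrank k M :=
  LinearEquiv.finrank_eq
    { RestrictScalars.addEquiv k R M with
      map_smul' := fun c x => by
        simp only [AddEquiv.toEquiv_eq_coe, Equiv.toFun_as_coe, EquivLike.coe_coe,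
          RestrictScalars.addEquiv_map_smul, algebraMap_smul, RingHom.id_apply] }

theorem finrank_homology_add_two_mul_finrank_range {k R : Type*} [Field k] [CommRing R]
    [Nontrivial R] [Algebra k R] [Module.Finite k R]
    {P₀ P₁ P₂ : Type*} [AddCommGroup P₀] [Module R P₀] [Module k P₀] [IsScalarTower k R P₀]
    [AddCommGroup P₁] [Module R P₁] [Module k P₁] [IsScalarTower k R P₁]
    [AddCommGroup P₂] [Module R P₂] [Module k P₂] [IsScalarTower k R P₂]
    [Module.Free R P₀] [Module.Finite R P₀] [Module.Free R P₁] [Module.Finite R P₁]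
    [Module.Free R P₂] [Module.Finite R P₂] (f₁ : P₁ →ₗ[R] P₀) (f₂ : P₂ →ₗ[R] P₁)
    (hcomp : f₁ ∘ₗ f₂ = 0) :
    Module.finrank k (LinearMap.ker f₂) +
        Module.finrank k ((LinearMap.ker f₁) ⧸
          (LinearMap.range f₂).comap (LinearMap.ker f₁).subtype) +
        Module.finrank k (P₀ ⧸ LinearMap.range f₁) +
      2 * (Module.finrank k (LinearMap.range f₁) + Module.finrank k (LinearMap.range f₂)) =
    Module.finrank k R * (Module.finrank R P₀ + Module.finrank R P₁ + Module.finrank R P₂) := by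
  have : Module.Finite k P₁ := Module.Finite.trans R P₁
  have : Module.Finite k P₂ := Module.Finite.trans R P₂
  have : Module.Finite k P₀ := Module.Finite.trans R P₀
  have : Module.Finite k (LinearMap.ker f₁) :=
    inferInstanceAs (Module.Finite k ((LinearMap.ker f₁).restrictScalars k))
  have hr₁ := f₁.finrank_range_add_finrank_ker_of_tower (k := k)
  have hr₂ := f₂.finrank_range_add_finrank_ker_of_tower (k := k)
  have hq₀ : Module.finrank k (P₀ ⧸ LinearMap.range f₁) + Module.finrank k (LinearMap.range f₁) =
      Module.finrank k P₀ :=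
    Submodule.finrank_quotient_add_finrank ((LinearMap.range f₁).restrictScalars k)
  have hq₁ : Module.finrank k ((LinearMap.ker f₁) ⧸
        (LinearMap.range f₂).comap (LinearMap.ker f₁).subtype) +
      Module.finrank k ((LinearMap.range f₂).comap (LinearMap.ker f₁).subtype) =
      Module.finrank k (LinearMap.ker f₁) :=
    Submodule.finrank_quotient_add_finrank
      (((LinearMap.range f₂).comap (LinearMap.ker f₁).subtype).restrictScalars k)
  have he : Module.finrank k ((LinearMap.range f₂).comap (LinearMap.ker f₁).subtype) =
      Module.finrank k (LinearMap.range f₂) :=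
    ((Submodule.comapSubtypeEquivOfLe
      (LinearMap.range_le_ker_iff.2 hcomp)).restrictScalars k).finrank_eq
  rw [mul_add (Module.finrank k R), mul_add (Module.finrank k R)]
  simp only [Module.finrank_mul_finrank]
  omega

theorem finrank_le_two_mul_finrank_homology {k R : Type*} [Field k] [CommRing R] [Algebra k R]
    [CharP R 2] [IsLocalRing R] [Module.Finite k R] (hR : ∀ y : R, ¬ IsUnit y → y ^ 2 = 0)
    {P₀ P₁ P₂ : Type*} [AddCommGroup P₀] [Module R P₀] [AddCommGroup P₁] [Module R P₁]
    [AddCommGroup P₂] [Module R P₂]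
    [Module.Free R P₀] [Module.Finite R P₀] [Module.Free R P₁] [Module.Finite R P₁]
    [Module.Free R P₂] [Module.Finite R P₂] (f₁ : P₁ →ₗ[R] P₀) (f₂ : P₂ →ₗ[R] P₁)
    (hcomp : f₁ ∘ₗ f₂ = 0)
    (hne : ¬ (Function.Injective f₂ ∧ LinearMap.range f₂ = LinearMap.ker f₁ ∧
      Function.Surjective f₁)) :
    Module.finrank k R ≤
      2 * (Module.finrank k (RestrictScalars k R (LinearMap.ker f₂)) +
        Module.finrank k (RestrictScalars k R
          ((LinearMap.ker f₁) ⧸ (LinearMap.range f₂).comap (LinearMap.ker f₁).subtype)) +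
        Module.finrank k (RestrictScalars k R (P₀ ⧸ LinearMap.range f₁))) := by
  let : Module k P₀ := Module.compHom P₀ (algebraMap k R)
  let : Module k P₁ := Module.compHom P₁ (algebraMap k R)
  let : Module k P₂ := Module.compHom P₂ (algebraMap k R)
  have : IsScalarTower k R P₀ := .of_algebraMap_smul fun _ _ => rfl
  have : IsScalarTower k R P₁ := .of_algebraMap_smul fun _ _ => rfl
  have : IsScalarTower k R P₂ := .of_algebraMap_smul fun _ _ => rfl
  have : Module.Finite k P₀ := Module.Finite.trans R P₀
  have : Module.Finite k P₁ := Module.Finite.trans R P₁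
  have : Module.Finite k P₂ := Module.Finite.trans R P₂
  have : Module.Finite k (LinearMap.ker f₁) :=
    inferInstanceAs (Module.Finite k ((LinearMap.ker f₁).restrictScalars k))
  have : Module.Finite k (LinearMap.ker f₂) :=
    inferInstanceAs (Module.Finite k ((LinearMap.ker f₂).restrictScalars k))
  have : Module.Finite k (P₀ ⧸ LinearMap.range f₁) :=
    inferInstanceAs (Module.Finite k (P₀ ⧸ (LinearMap.range f₁).restrictScalars k))
  have : Module.Finite k ((LinearMap.ker f₁) ⧸
      (LinearMap.range f₂).comap (LinearMap.ker f₁).subtype) :=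
    inferInstanceAs (Module.Finite k ((LinearMap.ker f₁) ⧸
      ((LinearMap.range f₂).comap (LinearMap.ker f₁).subtype).restrictScalars k))
  simp only [RestrictScalars.finrank_eq]
  have hh := finrank_homology_add_two_mul_finrank_range (k := k) f₁ f₂ hcomp
  have hbound := finrank_add_four_mul_finrank_range_le (k := k) hR _ P₀ P₁ P₂ f₁ f₂ hcomp rfl
  have hpos : Module.finrank k (LinearMap.ker f₂) +
        Module.finrank k ((LinearMap.ker f₁) ⧸
          (LinearMap.range f₂).comap (LinearMap.ker f₁).subtype) +
        Module.finrank k (P₀ ⧸ LinearMap.range f₁) ≠ 0 := by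
    intro h0
    simp only [Nat.add_eq_zero_iff, Module.finrank_zero_iff] at h0
    obtain ⟨⟨h₂, h₁⟩, h₀⟩ := h0
    rw [Submodule.Quotient.subsingleton_iff] at h₁ h₀
    refine hne ⟨LinearMap.ker_eq_bot.1 (Submodule.subsingleton_iff_eq_bot.1 h₂),
      le_antisymm (LinearMap.range_le_ker_iff.2 hcomp) ?_, LinearMap.range_eq_top.1 h₀⟩
    exact Submodule.comap_subtype_eq_top.1 h₁
  have := hbound (by omega)
  omega

/-- Let `k` be a field of characteristic `2` and
`R = k[x_1, …, x_d]/(x_1², …, x_d²)`.  If `P = (0 → P₂ →f₂ P₁ →f₁ P₀ → 0)` is a complex of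
finite rank free `R`-modules concentrated in degrees `0, 1, 2` with nonzero homology
(`H₂ = ker f₂`, `H₁ = ker f₁ / im f₂`, `H₀ = coker f₁`), then
`h(P) = dim_k H₂ + dim_k H₁ + dim_k H₀ ≥ 2^{d−1}`. -/
theorem stmt18 (k : Type) [Field k] [CharP k 2] (d : ℕ)
    (P₀ P₁ P₂ : Type) [AddCommGroup P₀] [Module (SqZeroRing k d) P₀]
    [AddCommGroup P₁] [Module (SqZeroRing k d) P₁]
    [AddCommGroup P₂] [Module (SqZeroRing k d) P₂]
    [Module.Free (SqZeroRing k d) P₀] [Module.Finite (SqZeroRing k d) P₀]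
    [Module.Free (SqZeroRing k d) P₁] [Module.Finite (SqZeroRing k d) P₁]
    [Module.Free (SqZeroRing k d) P₂] [Module.Finite (SqZeroRing k d) P₂]
    (f₁ : P₁ →ₗ[SqZeroRing k d] P₀) (f₂ : P₂ →ₗ[SqZeroRing k d] P₁)
    (hcomp : f₁.comp f₂ = 0)
    (hne : ¬ (Function.Injective f₂ ∧ LinearMap.range f₂ = LinearMap.ker f₁ ∧
      Function.Surjective f₁)) :
    (2 : ℝ) ^ ((d : ℤ) - 1) ≤
      ((Module.finrank k (RestrictScalars k (SqZeroRing k d) (LinearMap.ker f₂)) +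
        Module.finrank k (RestrictScalars k (SqZeroRing k d)
          ((LinearMap.ker f₁) ⧸ (LinearMap.range f₂).comap (LinearMap.ker f₁).subtype)) +
        Module.finrank k (RestrictScalars k (SqZeroRing k d)
          (P₀ ⧸ LinearMap.range f₁)) : ℕ) : ℝ) := by
  have h := (SqZeroRing.two_pow_le_finrank_s18 k d).trans (finrank_le_two_mul_finrank_homology
    (fun _ => SqZeroRing.sq_eq_zero_of_not_isUnit k d) f₁ f₂ hcomp hne)
  rw [zpow_sub_one₀ two_ne_zero, zpow_natCast, ← div_eq_mul_inv, div_le_iff₀' two_pos]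
  exact_mod_cast h
end
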